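/- arXiv:1203.2040 — 2 statements merged into one kernel-verified Lean document; each statement's English description precedes it below -/
import Mathlib

section
/- Let Γ be a reduced finite set of points in P^n over a field K of characteristic 0, with n ≥ 2, not all contained in a hyperplane. If 0 → F_n = ⊕_i R(-a_i) → ⋯ → F_1 → R → R/I(Γ) → 0 is the graded minimal free resolution of R/I(Γ), and A_n = min_i {a_i − n} is the minimum socle degree, then the minimum distance satisfies d(Γ) ≥ A_n. -/
open MvPolynomial

noncomputable section

namespace PointsMinDist

variable {K : Type} [Field K]

/-- The (homogeneous) vanishing ideal of a set of points of projective space: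
all polynomials vanishing at every representative vector of every point. -/
def vanishingIdeal {m : ℕ} (Γ : Set (Projectivization K (Fin m → K))) :
    Ideal (MvPolynomial (Fin m) K) where
  carrier := {f | ∀ P ∈ Γ, ∀ (v : Fin m → K) (hv : v ≠ 0),
      Projectivization.mk K v hv = P → MvPolynomial.eval v f = 0}
  zero_mem' := by intro P hP v hv h; simp
  add_mem' := by
    intro f g hf hg P hP v hv h
    simp [hf P hP v hv h, hg P hP v hv h]
  smul_mem' := by
    intro c f hf P hP v hv h
    simp [smul_eq_mul, hf P hP v hv h]

/-- The degree-`d` graded component of a (homogeneous) ideal, as a `K`-subspace. -/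
def degPart {m : ℕ} (I : Ideal (MvPolynomial (Fin m) K)) (d : ℕ) :
    Submodule K (MvPolynomial (Fin m) K) :=
  Submodule.restrictScalars K I ⊓ homogeneousSubmodule (Fin m) K d

/-- `K`-dimension of the degree-`d` component of an ideal. -/
def hdim {m : ℕ} (I : Ideal (MvPolynomial (Fin m) K)) (d : ℕ) : ℕ :=
  Module.finrank K (degPart I d)

/-- Hilbert function of `R/I` in degree `d`. -/
def HF {m : ℕ} (I : Ideal (MvPolynomial (Fin m) K)) (d : ℕ) : ℕ :=
  Module.finrank K (homogeneousSubmodule (Fin m) K d) - hdim I d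

open Classical in
/-- `hyp Γ`: the maximum number of points of `Γ` contained in a hyperplane. -/
def hyp {m : ℕ} (Γ : Finset (Projectivization K (Fin m → K))) : ℕ :=
  sSup {k | ∃ φ : Module.Dual K (Fin m → K), φ ≠ 0 ∧
    k = (Γ.filter fun P => φ P.rep = 0).card}

/-- the minimum distance `d(Γ) = |Γ| - hyp(Γ)`. -/
def minDist {m : ℕ} (Γ : Finset (Projectivization K (Fin m → K))) : ℕ :=
  Γ.card - hyp Γ

/-- `Γ` is non-degenerate: it is not contained in any hyperplane. -/
def Nondeg {m : ℕ} (Γ : Finset (Projectivization K (Fin m → K))) : Prop :=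
  ∀ φ : Module.Dual K (Fin m → K), (∀ P ∈ Γ, φ P.rep = 0) → φ = 0

/-- The higher minimum distance `d(Γ)ₐ = |Γ| - max{|Γ'| : Γ' ⊆ Γ, dim I(Γ')ₐ > dim I(Γ)ₐ}`. -/
def higherD {m : ℕ} (Γ : Finset (Projectivization K (Fin m → K))) (a : ℕ) : ℕ :=
  Γ.card - sSup {k | ∃ Γ' ⊆ Γ,
    hdim (vanishingIdeal (Γ' : Set (Projectivization K (Fin m → K)))) a >
      hdim (vanishingIdeal (Γ : Set (Projectivization K (Fin m → K)))) a ∧ k = Γ'.card}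

open Classical in
/-- The degree `δ(P)` of a point `P` in `Γ`: the least degree in which the ideal
of `Γ \ {P}` is strictly bigger than the ideal of `Γ`. -/
def pointDegree {m : ℕ} (Γ : Finset (Projectivization K (Fin m → K)))
    (P : Projectivization K (Fin m → K)) : ℕ :=
  sInf {d | hdim (vanishingIdeal ((Γ.erase P) : Set (Projectivization K (Fin m → K)))) d >
    hdim (vanishingIdeal (Γ : Set (Projectivization K (Fin m → K)))) d}

/-- A graded minimal free resolution
`0 → F_len → ⋯ → F_1 → R → R/I → 0` of `R/I`, `R = K[x_0,…,x_{N-1}]`.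
`F_j = ⊕_{i : Fin (rk j)} R(-(twist j i))` for `1 ≤ j ≤ len`.
The differential `F_1 → R` is given by `gen` (so that its image is `I`) and the
differential `F_{j+2} → F_{j+1}` is given (in matrix form, rows indexed by the
target) by `mat j`.  All entries are homogeneous of the appropriate degrees, and
minimality means all entries lie in the irrelevant maximal ideal
(zero constant coefficient). -/
structure MinFreeRes (N : ℕ) (K : Type) [Field K] (I : Ideal (MvPolynomial (Fin N) K)) where
  len : ℕ
  rk : ℕ → ℕ
  twist : (j : ℕ) → Fin (rk j) → ℕ
  gen : Fin (rk 1) → MvPolynomial (Fin N) K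
  mat : (j : ℕ) → Matrix (Fin (rk (j + 1))) (Fin (rk (j + 2))) (MvPolynomial (Fin N) K)
  rk_len_pos : 0 < rk len
  rk_eq_zero : ∀ j, len < j → rk j = 0
  gen_hom : ∀ i, (gen i).IsHomogeneous (twist 1 i)
  gen_min : ∀ i, constantCoeff (gen i) = 0
  gen_span : Ideal.span (Set.range gen) = I
  mat_hom : ∀ j i i', mat j i i' = 0 ∨
    ∃ d, (mat j i i').IsHomogeneous d ∧ d + twist (j + 1) i = twist (j + 2) i'
  mat_min : ∀ j i i', constantCoeff (mat j i i') = 0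
  exact_one : ∀ v : Fin (rk 1) → MvPolynomial (Fin N) K,
    (∑ i, v i * gen i = 0) ↔ v ∈ LinearMap.range (mat 0).mulVecLin
  exact_rest : ∀ j, LinearMap.ker (mat j).mulVecLin = LinearMap.range (mat (j + 1)).mulVecLin

/-- `a(Γ)`: the minimal twist `min_i {a_i}` occurring in the last module
`F_len = ⊕ R(-a_i)` of the minimal free resolution. -/
def MinFreeRes.aMin {N : ℕ} {K : Type} [Field K] {I : Ideal (MvPolynomial (Fin N) K)}
    (res : MinFreeRes N K I) : ℕ :=
  Finset.univ.inf'
    (Finset.univ_nonempty_iff.mpr (Fin.pos_iff_nonempty.mp res.rk_len_pos))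
    (fun i => res.twist res.len i)

/-- The minimum socle degree `A_n = min_i {a_i - n}` (here `n = len`, the length of
the resolution). -/
def MinFreeRes.A {N : ℕ} {K : Type} [Field K] {I : Ideal (MvPolynomial (Fin N) K)}
    (res : MinFreeRes N K I) : ℤ :=
  (res.aMin : ℤ) - res.len


/-! ### Shifted homogeneous components -/

/-- The component of `f` of degree `D - s`, zero when `D < s`. -/
def shiftComp {N : ℕ} (D s : ℕ) (f : MvPolynomial (Fin N) K) : MvPolynomial (Fin N) K :=
  if s ≤ D then homogeneousComponent (D - s) f else 0

/-- `f` is homogeneous of degree `D - s` (zero if `D < s`). -/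
def ShiftHom {N : ℕ} (D s : ℕ) (f : MvPolynomial (Fin N) K) : Prop :=
  f = 0 ∨ ∃ d, f.IsHomogeneous d ∧ d + s = D

lemma shiftComp_hom {N : ℕ} (D s : ℕ) (f : MvPolynomial (Fin N) K) :
    ShiftHom D s (shiftComp D s f) := by
  unfold shiftComp ShiftHom
  split_ifs with h
  · exact Or.inr ⟨D - s, homogeneousComponent_isHomogeneous _ _, by omega⟩
  · exact Or.inl rfl

lemma shiftComp_self {N : ℕ} {D s : ℕ} {f : MvPolynomial (Fin N) K} (h : ShiftHom D s f) :
    shiftComp D s f = f := by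
  unfold shiftComp
  rcases h with rfl | ⟨d, hd, rfl⟩
  · simp
  · simp [homogeneousComponent_eq_self hd]

lemma homComp_mul {N : ℕ} {a : ℕ} (k : ℕ) {g : MvPolynomial (Fin N) K} (hg : g.IsHomogeneous a)
    (f : MvPolynomial (Fin N) K) :
    homogeneousComponent k (g * f) =
      if a ≤ k then g * homogeneousComponent (k - a) f else 0 := by
  conv_lhs => rw [← sum_homogeneousComponent f, Finset.mul_sum, map_sum]
  have h1 : ∀ i, homogeneousComponent k (g * homogeneousComponent i f) =
      if k = a + i then g * homogeneousComponent i f else 0 := by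
    intro i
    rw [homogeneousComponent_of_mem (m := k) (n := a + i)
      (hg.mul (homogeneousComponent_isHomogeneous i f))]
  simp only [h1]
  split_ifs with h
  · by_cases hk : k - a ∈ Finset.range (f.totalDegree + 1)
    · rw [Finset.sum_eq_single_of_mem _ hk]
      · rw [if_pos (by omega)]
      · intro b _ hb
        rw [if_neg (by omega)]
    · rw [homogeneousComponent_eq_zero (k - a) f (by simp at hk; omega), mul_zero]
      refine Finset.sum_eq_zero fun i hi => ?_
      rw [if_neg]
      rintro rfl
      simp at hk hi
      omega
  · refine Finset.sum_eq_zero fun i hi => ?_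
    rw [if_neg (by omega)]

lemma shiftComp_mul {N : ℕ} {D s t : ℕ} {g : MvPolynomial (Fin N) K} (hg : ShiftHom t s g)
    (f : MvPolynomial (Fin N) K) :
    shiftComp D s (g * f) = g * shiftComp D t f := by
  rcases hg with rfl | ⟨a, ha, rfl⟩
  · simp [shiftComp]
  · unfold shiftComp
    split_ifs with h1 h2 h2
    · rw [homComp_mul _ ha, if_pos (by omega)]
      congr 3
      omega
    · rw [homComp_mul _ ha, if_neg (by omega), mul_zero]
    · omega
    · simp

lemma shiftComp_sub {N : ℕ} {D s : ℕ} (f g : MvPolynomial (Fin N) K) :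
    shiftComp D s (f - g) = shiftComp D s f - shiftComp D s g := by
  unfold shiftComp
  split_ifs <;> simp

lemma shiftComp_sum {N : ℕ} {D s : ℕ} {ι : Type*} (S : Finset ι)
    (f : ι → MvPolynomial (Fin N) K) :
    shiftComp D s (∑ i ∈ S, f i) = ∑ i ∈ S, shiftComp D s (f i) := by
  unfold shiftComp
  split_ifs <;> simp

/-! ### The linear forms of a point and the ideals they generate -/

/-- The linear form `x_j - v_j x_{i0}`. -/
def lf {N : ℕ} (v : Fin N → K) (i0 j : Fin N) : MvPolynomial (Fin N) K :=
  X j - C (v j) * X i0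

lemma lf_hom {N : ℕ} (v : Fin N → K) (i0 j : Fin N) : (lf v i0 j).IsHomogeneous 1 :=
  (isHomogeneous_X K j).sub (isHomogeneous_C_mul_X _ _)

/-- Ideal generated by the linear forms with index in `T`. -/
def pI {N : ℕ} (v : Fin N → K) (i0 : Fin N) (T : Finset (Fin N)) :
    Ideal (MvPolynomial (Fin N) K) :=
  Ideal.span (lf v i0 '' (T : Set (Fin N)))

/-- Substitution killing the forms with index in `T`. -/
def sg {N : ℕ} (v : Fin N → K) (i0 : Fin N) (T : Finset (Fin N)) :
    MvPolynomial (Fin N) K →ₐ[K] MvPolynomial (Fin N) K :=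
  aeval fun j => if j ∈ T then C (v j) * X i0 else X j

lemma pI_eq_ker {N : ℕ} (v : Fin N → K) (i0 : Fin N) (T : Finset (Fin N)) (h0 : i0 ∉ T) :
    pI v i0 T = RingHom.ker (sg v i0 T) := by
  apply le_antisymm
  · rw [pI, Ideal.span_le]
    rintro _ ⟨j, hj, rfl⟩
    have hj' : j ∈ T := hj
    simp [RingHom.mem_ker, lf, sg, hj', h0, algebraMap_eq]
  · intro f hf
    have key : (Ideal.Quotient.mkₐ K (pI v i0 T)).comp (sg v i0 T) =
        Ideal.Quotient.mkₐ K (pI v i0 T) := by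
      apply MvPolynomial.algHom_ext
      intro j
      by_cases hj : j ∈ T
      · have : lf v i0 j ∈ pI v i0 T := Ideal.subset_span ⟨j, hj, rfl⟩
        simp only [sg, AlgHom.comp_apply, aeval_X, hj, if_true, Ideal.Quotient.mkₐ_eq_mk]
        symm
        rw [Ideal.Quotient.eq]
        exact this
      · simp [sg, hj]
    have h2 := congrArg (fun φ => φ f) key
    simp only [AlgHom.comp_apply] at h2
    rw [RingHom.mem_ker] at hf
    rw [hf, map_zero] at h2
    exact Ideal.Quotient.eq_zero_iff_mem.mp h2.symm

lemma pI_cancel {N : ℕ} (v : Fin N → K) (i0 : Fin N) (T : Finset (Fin N)) (h0 : i0 ∉ T)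
    {m : Fin N} (hm : m ∉ T) (hm0 : m ≠ i0) {f : MvPolynomial (Fin N) K}
    (h : lf v i0 m * f ∈ pI v i0 T) : f ∈ pI v i0 T := by
  rw [pI_eq_ker v i0 T h0] at *
  have hp : (RingHom.ker (sg v i0 T)).IsPrime := RingHom.ker_isPrime _
  rcases hp.mem_or_mem h with h1 | h1
  · exfalso
    rw [RingHom.mem_ker] at h1
    simp only [lf, sg, map_sub, map_mul, aeval_X, hm, h0, if_false, aeval_C, algebraMap_eq] at h1
    have h2 := congrArg (eval (Pi.single m (1 : K))) h1
    simp [hm0.symm] at h2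
  · exact h1

lemma pI_insert {N : ℕ} (v : Fin N → K) (i0 m : Fin N) (T : Finset (Fin N))
    {f : MvPolynomial (Fin N) K} :
    f ∈ pI v i0 (insert m T) ↔ ∃ a, f - lf v i0 m * a ∈ pI v i0 T := by
  unfold pI
  rw [Finset.coe_insert, Set.image_insert_eq, Ideal.mem_span_insert]
  constructor
  · rintro ⟨a, z, hz, rfl⟩
    exact ⟨a, by convert hz using 1; ring⟩
  · rintro ⟨a, h⟩
    exact ⟨a, _, h, by ring⟩

lemma pI_shiftComp {N : ℕ} (v : Fin N → K) (i0 : Fin N) (T : Finset (Fin N)) (D s : ℕ)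
    {f : MvPolynomial (Fin N) K} (hf : f ∈ pI v i0 T) : shiftComp D s f ∈ pI v i0 T := by
  unfold shiftComp
  split_ifs
  · let _ := gradedAlgebra (σ := Fin N) (R := K)
    refine homogeneousComponent_mem_of_mem ?_ hf _
    apply Ideal.homogeneous_span
    rintro _ ⟨j, -, rfl⟩
    exact ⟨1, lf_hom v i0 j⟩
  · exact zero_mem _

/-! ### The induction over the linear forms -/

/-- Key lemma: an exact graded complex of free modules, and an element of degree `e` of the
zeroth module which is not a boundary but is multiplied into the boundaries by all the linear
forms of a point, give a nonzero element of degree `e + k` in the `k`-th module. -/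
lemma key_induction {N : ℕ} (v : Fin N → K) (i0 : Fin N) (r : ℕ → ℕ)
    (t : (j : ℕ) → Fin (r j) → ℕ)
    (M : (j : ℕ) → Matrix (Fin (r j)) (Fin (r (j + 1))) (MvPolynomial (Fin N) K))
    (hhom : ∀ j i i', ShiftHom (t (j + 1) i') (t j i) (M j i i'))
    (hex : ∀ j x, (M j).mulVec x = 0 → ∃ u, x = (M (j + 1)).mulVec u)
    (hMM : ∀ j u, (M j).mulVec ((M (j + 1)).mulVec u) = 0)
    (e : ℕ) (z0 : Fin (r 0) → MvPolynomial (Fin N) K)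
    (hz0 : ∀ i, ShiftHom e (t 0 i) (z0 i))
    (hz1 : ∀ u, z0 ≠ (M 0).mulVec u)
    (hz2 : ∀ m, m ≠ i0 → ∃ w, lf v i0 m • z0 = (M 0).mulVec w)
    (T : Finset (Fin N)) (hT : i0 ∉ T) :
    (∀ j, T.card ≤ j → ∀ x, (∀ i, (M j).mulVec x i ∈ pI v i0 T) →
      ∃ u, ∀ i, (x - (M (j + 1)).mulVec u) i ∈ pI v i0 T) ∧
    ∀ k, k = T.card →
    ∃ z : Fin (r k) → MvPolynomial (Fin N) K,
      (∀ i, ShiftHom (e + k) (t k i) (z i)) ∧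
      (∀ u, ¬ ∀ i, (z - (M k).mulVec u) i ∈ pI v i0 T) ∧
      (∀ m, m ∉ T → m ≠ i0 →
        ∃ w, ∀ i, (lf v i0 m • z - (M k).mulVec w) i ∈ pI v i0 T) := by
  induction T using Finset.induction_on with
  | empty =>
    have hb : ∀ f, f ∈ pI v i0 ∅ ↔ f = 0 := by simp [pI]
    refine ⟨?_, ?_⟩
    · intro j _ x hx
      obtain ⟨u, hu⟩ := hex j x (funext fun i => (hb _).1 (hx i))
      exact ⟨u, fun i => by rw [hb, hu]; simp⟩
    · rintro k rfl
      refine ⟨z0, hz0, ?_, ?_⟩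
      · intro u hu
        exact hz1 u (sub_eq_zero.1 (funext fun i => (hb _).1 (hu i)))
      · intro m _ hm
        obtain ⟨w, hw⟩ := hz2 m hm
        refine ⟨w, fun i => ?_⟩
        rw [hb]
        exact congrFun (sub_eq_zero.2 hw) i
  | insert m T hmT ih =>
    have h0 : i0 ∉ T := fun h => hT (Finset.mem_insert_of_mem h)
    have hm0 : m ≠ i0 := fun h => hT (h ▸ Finset.mem_insert_self _ _)
    obtain ⟨ihE, ihZ⟩ := ih h0
    have hcard : (insert m T).card = T.card + 1 := Finset.card_insert_of_notMem hmT
    -- vectors in the ideal are mapped to vectors in the ideal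
    have hmul : ∀ j x, (∀ i, x i ∈ pI v i0 T) → ∀ i, (M j).mulVec x i ∈ pI v i0 T := by
      intro j x hx i
      rw [Matrix.mulVec, dotProduct]
      exact Ideal.sum_mem _ fun i' _ => Ideal.mul_mem_left _ _ (hx i')
    refine ⟨?_, ?_⟩
    · intro j hj x hx
      rw [hcard] at hj
      obtain ⟨j, rfl⟩ : ∃ j', j = j' + 1 := ⟨j - 1, by omega⟩
      choose y hy using fun i => (pI_insert v i0 m T).1 (hx i)
      have hy' : ∀ i, ((M (j + 1)).mulVec x - lf v i0 m • y) i ∈ pI v i0 T := hy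
      have h1 : ∀ i, (M j).mulVec y i ∈ pI v i0 T := by
        intro i
        refine pI_cancel v i0 T h0 hmT hm0 ?_
        have h2 := hmul j _ hy' i
        rw [Matrix.mulVec_sub, hMM, Matrix.mulVec_smul, zero_sub, Pi.neg_apply,
          neg_mem_iff] at h2
        exact h2
      obtain ⟨s, hs⟩ := ihE j (by omega) y h1
      obtain ⟨u, hu⟩ := ihE (j + 1) (by omega) (x - lf v i0 m • s) (by
        intro i
        have h3 := add_mem (hy' i) (Ideal.mul_mem_left _ (lf v i0 m) (hs i))
        convert h3 using 1
        rw [Matrix.mulVec_sub, Matrix.mulVec_smul]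
        simp only [Pi.sub_apply, Pi.smul_apply, smul_eq_mul]
        ring)
      refine ⟨u, fun i => (pI_insert v i0 m T).2 ⟨s i, ?_⟩⟩
      convert hu i using 1
      simp only [Pi.sub_apply, Pi.smul_apply, smul_eq_mul]
      ring
    · rintro k hk
      rw [hcard] at hk
      subst hk
      obtain ⟨z, hzh, hzn, hzk⟩ := ihZ _ rfl
      obtain ⟨w0, hw0⟩ := hzk m hmT hm0
      set w : Fin (r (T.card + 1)) → MvPolynomial (Fin N) K :=
        fun i => shiftComp (e + (T.card + 1)) (t _ i) (w0 i) with hw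
      have hw1 : ∀ i, (lf v i0 m • z - (M T.card).mulVec w) i ∈ pI v i0 T := by
        intro i
        have h1 := pI_shiftComp v i0 T (e + (T.card + 1)) (t _ i) (hw0 i)
        convert h1 using 1
        simp only [Pi.sub_apply, Pi.smul_apply, smul_eq_mul, shiftComp_sub, Matrix.mulVec,
          dotProduct, shiftComp_sum]
        congr 1
        · rw [shiftComp_self]
          rcases hzh i with h | ⟨d, hd, hd2⟩
          · left; simp [h]
          · right; exact ⟨1 + d, (lf_hom v i0 m).mul hd, by omega⟩
        · refine Finset.sum_congr rfl fun i' _ => ?_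
          rw [shiftComp_mul (hhom _ _ _)]
      refine ⟨w, fun i => shiftComp_hom _ _ _, ?_, ?_⟩
      · intro u hu
        choose y hy using fun i => (pI_insert v i0 m T).1 (hu i)
        have hy' : ∀ i, (w - (M (T.card + 1)).mulVec u - lf v i0 m • y) i ∈ pI v i0 T := hy
        refine hzn y fun i => pI_cancel v i0 T h0 hmT hm0 ?_
        have h2 := hmul _ _ hy' i
        rw [Matrix.mulVec_sub, Matrix.mulVec_sub, hMM, Matrix.mulVec_smul, sub_zero] at h2
        have h3 := add_mem (hw1 i) h2
        convert h3 using 1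
        simp only [Pi.sub_apply, Pi.smul_apply, smul_eq_mul]
        ring
      · intro m' hm' hne
        obtain ⟨w', hw'⟩ := hzk m' (fun h => hm' (Finset.mem_insert_of_mem h)) hne
        obtain ⟨u, hu⟩ := ihE T.card le_rfl (lf v i0 m' • w - lf v i0 m • w') (by
          intro i
          have h3 := sub_mem (Ideal.mul_mem_left _ (lf v i0 m) (hw' i))
            (Ideal.mul_mem_left _ (lf v i0 m') (hw1 i))
          convert h3 using 1
          rw [Matrix.mulVec_sub, Matrix.mulVec_smul, Matrix.mulVec_smul]
          simp only [Pi.sub_apply, Pi.smul_apply, smul_eq_mul]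
          ring)
        refine ⟨u, fun i => (pI_insert v i0 m T).2 ⟨w' i, ?_⟩⟩
        convert hu i using 1
        simp only [Pi.sub_apply, Pi.smul_apply, smul_eq_mul]
        ring

/-! ### Linear forms as polynomials -/

/-- The polynomial of a linear functional. -/
def linPoly {N : ℕ} (φ : Module.Dual K (Fin N → K)) : MvPolynomial (Fin N) K :=
  ∑ i, C (φ (Pi.single i 1)) * X i

lemma linPoly_hom {N : ℕ} (φ : Module.Dual K (Fin N → K)) : (linPoly φ).IsHomogeneous 1 :=
  IsHomogeneous.sum _ _ _ fun _ _ => isHomogeneous_C_mul_X _ _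

lemma linPoly_eval {N : ℕ} (φ : Module.Dual K (Fin N → K)) (v : Fin N → K) :
    eval v (linPoly φ) = φ v := by
  simp only [linPoly, map_sum, map_mul, eval_C, eval_X]
  conv_rhs => rw [LinearMap.pi_apply_eq_sum_univ φ v]
  refine Finset.sum_congr rfl fun i _ => ?_
  rw [smul_eq_mul, mul_comm]
  congr 2
  ext j
  simp [Pi.single_apply, eq_comm]

lemma exists_dual_sep {N : ℕ} {P Q : Projectivization K (Fin N → K)} (h : P ≠ Q) :
    ∃ φ : Module.Dual K (Fin N → K), φ P.rep = 0 ∧ φ Q.rep ≠ 0 := by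
  have h1 : Q.rep ∉ Submodule.span K {P.rep} := by
    intro hm
    obtain ⟨a, ha⟩ := Submodule.mem_span_singleton.1 hm
    apply h
    rw [← P.mk_rep, ← Q.mk_rep, eq_comm, Projectivization.mk_eq_mk_iff']
    exact ⟨a, ha⟩
  obtain ⟨φ, h2, h3⟩ := Submodule.exists_le_ker_of_notMem h1
  exact ⟨φ, h3 (Submodule.mem_span_singleton_self _), h2⟩

open Classical in
/-- There are `Q ∈ Γ` and a form of degree `minDist Γ` vanishing on `Γ \ {Q}` but not at `Q`. -/
lemma exists_separator {n : ℕ} (Γ : Finset (Projectivization K (Fin (n + 1) → K)))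
    (hnd : Nondeg Γ) :
    ∃ Q ∈ Γ, ∃ F : MvPolynomial (Fin (n + 1)) K, F.IsHomogeneous (minDist Γ) ∧
      eval Q.rep F ≠ 0 ∧ ∀ P ∈ Γ, P ≠ Q → ∀ c : K, eval (c • P.rep) F = 0 := by
  have hmem : hyp Γ ∈ {k | ∃ φ : Module.Dual K (Fin (n + 1) → K), φ ≠ 0 ∧
      k = (Γ.filter fun P => φ P.rep = 0).card} := by
    apply Nat.sSup_mem
    · refine ⟨_, LinearMap.proj 0, ?_, rfl⟩
      intro h
      have := congrArg (fun φ => φ (Pi.single 0 (1 : K))) h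
      simp at this
    · refine ⟨Γ.card, ?_⟩
      rintro _ ⟨φ, -, rfl⟩
      exact Finset.card_filter_le _ _
  obtain ⟨φ, hφ, hk⟩ := hmem
  have hd : minDist Γ = (Γ.filter fun P => ¬ φ P.rep = 0).card := by
    have := Finset.card_filter_add_card_filter_not (s := Γ) (fun P => φ P.rep = 0)
    unfold minDist
    omega
  obtain ⟨Q, hQ, hQ0⟩ : ∃ Q ∈ Γ, φ Q.rep ≠ 0 := by
    by_contra! h
    exact hφ (hnd φ h)
  have hsep : ∀ P : Projectivization K (Fin (n + 1) → K), ∃ ψ : Module.Dual K (Fin (n + 1) → K),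
      (P ≠ Q → ψ P.rep = 0) ∧ ψ Q.rep ≠ 0 ∧ (P = Q → ψ = φ) := by
    intro P
    by_cases h : P = Q
    · exact ⟨φ, fun h' => absurd h h', hQ0, fun _ => rfl⟩
    · obtain ⟨ψ, h1, h2⟩ := exists_dual_sep h
      exact ⟨ψ, fun _ => h1, h2, fun h' => absurd h' h⟩
  choose ψ h1 h2 h3 using hsep
  refine ⟨Q, hQ, ∏ P ∈ Γ.filter (fun P => ¬ φ P.rep = 0), linPoly (ψ P), ?_, ?_, ?_⟩
  · rw [hd, Finset.card_eq_sum_ones]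
    exact IsHomogeneous.prod _ _ _ fun P _ => linPoly_hom _
  · rw [map_prod, Finset.prod_ne_zero_iff]
    intro P _
    rw [linPoly_eval]
    exact h2 P
  · intro P hP hPQ c
    rw [map_prod, Finset.prod_eq_zero_iff]
    by_cases h : φ P.rep = 0
    · refine ⟨Q, Finset.mem_filter.2 ⟨hQ, hQ0⟩, ?_⟩
      rw [linPoly_eval, h3 Q rfl, map_smul, h, smul_zero]
    · refine ⟨P, Finset.mem_filter.2 ⟨hP, h⟩, ?_⟩
      rw [linPoly_eval, map_smul, h1 P hPQ, smul_zero]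

/-! ### The resolution extended by `F_0 = R` -/

/-- Ranks including `F_0 = R`. -/
def xr {N : ℕ} {I : Ideal (MvPolynomial (Fin N) K)} (res : MinFreeRes N K I) : ℕ → ℕ
  | 0 => 1
  | j + 1 => res.rk (j + 1)

/-- Twists including `F_0 = R`. -/
def xt {N : ℕ} {I : Ideal (MvPolynomial (Fin N) K)} (res : MinFreeRes N K I) :
    (j : ℕ) → Fin (xr res j) → ℕ
  | 0 => fun _ => 0
  | j + 1 => res.twist (j + 1)

/-- Differentials including `F_1 → R`. -/
def xM {N : ℕ} {I : Ideal (MvPolynomial (Fin N) K)} (res : MinFreeRes N K I) :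
    (j : ℕ) → Matrix (Fin (xr res j)) (Fin (xr res (j + 1))) (MvPolynomial (Fin N) K)
  | 0 => Matrix.of fun _ i => res.gen i
  | j + 1 => res.mat j

lemma xM_hom {N : ℕ} {I : Ideal (MvPolynomial (Fin N) K)} (res : MinFreeRes N K I) :
    ∀ j i i', ShiftHom (xt res (j + 1) i') (xt res j i) (xM res j i i')
  | 0, _, i' => Or.inr ⟨res.twist 1 i', res.gen_hom i', rfl⟩
  | j + 1, i, i' => res.mat_hom j i i'

lemma xM_zero {N : ℕ} {I : Ideal (MvPolynomial (Fin N) K)} (res : MinFreeRes N K I)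
    (u : Fin (res.rk 1) → MvPolynomial (Fin N) K) (i : Fin 1) :
    (xM res 0).mulVec u i = ∑ i, u i * res.gen i := by
  change ∑ i, res.gen i * u i = _
  exact Finset.sum_congr rfl fun i _ => mul_comm _ _

lemma xM_exact {N : ℕ} {I : Ideal (MvPolynomial (Fin N) K)} (res : MinFreeRes N K I) :
    ∀ j x, (xM res j).mulVec x = 0 ↔ ∃ u, x = (xM res (j + 1)).mulVec u
  | 0, x => by
    have h := res.exact_one x
    have h0 : (xM res 0).mulVec x = 0 ↔ ∑ i, x i * res.gen i = 0 := by
      constructor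
      · intro h
        exact (xM_zero res x 0).symm.trans (congrFun h (0 : Fin 1))
      · intro h
        ext1 i
        exact (xM_zero res x i).trans h
    refine h0.trans (h.trans ?_)
    exact ⟨fun ⟨u, hu⟩ => ⟨u, hu.symm⟩, fun ⟨u, hu⟩ => ⟨u, hu.symm⟩⟩
  | j + 1, x => by
    have h := SetLike.ext_iff.1 (res.exact_rest j) x
    exact h.trans ⟨fun ⟨u, hu⟩ => ⟨u, hu.symm⟩, fun ⟨u, hu⟩ => ⟨u, hu.symm⟩⟩

lemma mem_iff_xM {N : ℕ} {I : Ideal (MvPolynomial (Fin N) K)} (res : MinFreeRes N K I)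
    (f : MvPolynomial (Fin N) K) : f ∈ I ↔ ∃ u, (fun _ => f) = (xM res 0).mulVec u := by
  have h := SetLike.ext_iff.1 res.gen_span f
  refine h.symm.trans (Ideal.mem_span_range_iff_exists_fun.trans ?_)
  constructor
  · rintro ⟨c, hc⟩
    refine ⟨c, funext fun i => ?_⟩
    exact hc.symm.trans (xM_zero res c i).symm
  · rintro ⟨u, hu⟩
    exact ⟨u, (xM_zero res u 0).symm.trans (congrFun hu (0 : Fin 1)).symm⟩

/-- For a reduced non-degenerate finite set of points
`Γ ⊂ P^n` (`n ≥ 2`) over a field of characteristic `0`, with graded minimal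
free resolution `0 → F_n = ⊕ R(-a_i) → ⋯ → F_1 → R → R/I(Γ) → 0`, the minimum
distance satisfies `d(Γ) ≥ A_n = min {a_i - n}`. -/
theorem minDist_ge_minimum_socle_degree
    {K : Type} [Field K] [CharZero K] {n : ℕ} (hn : 2 ≤ n)
    (Γ : Finset (Projectivization K (Fin (n + 1) → K)))
    (hnd : Nondeg Γ)
    (res : MinFreeRes (n + 1) K (vanishingIdeal (Γ : Set (Projectivization K (Fin (n + 1) → K)))))
    (hlen : res.len = n) :
    res.A ≤ (minDist Γ : ℤ) := by
  obtain ⟨Q, hQ, F, hF, hFQ, hFP⟩ := exists_separator Γ hnd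
  obtain ⟨i0, hi0⟩ : ∃ i, Q.rep i ≠ 0 := by
    by_contra! h
    exact Q.rep_nonzero (funext h)
  set v : Fin (n + 1) → K := fun j => Q.rep j / Q.rep i0 with hv
  have hz1 : ∀ u, (fun _ => F) ≠ (xM res 0).mulVec u := by
    intro u hu
    have : F ∈ vanishingIdeal (Γ : Set (Projectivization K (Fin (n + 1) → K))) :=
      (mem_iff_xM res F).2 ⟨u, hu⟩
    exact hFQ (this Q hQ Q.rep Q.rep_nonzero Q.mk_rep)
  have hz2 : ∀ m, m ≠ i0 → ∃ w, (lf v i0 m • (fun _ => F) : Fin 1 → _) =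
      (xM res 0).mulVec w := by
    intro m _
    refine (mem_iff_xM res (lf v i0 m * F)).1 ?_
    intro P hP w hw hwP
    obtain ⟨c, hc⟩ : ∃ c : K, c • P.rep = w := by
      rw [← P.mk_rep, Projectivization.mk_eq_mk_iff'] at hwP
      obtain ⟨a, ha⟩ := hwP
      exact ⟨a, ha⟩
    subst hc
    rw [map_mul]
    by_cases hPQ : P = Q
    · subst hPQ
      simp only [lf, hv, map_sub, map_mul, eval_X, eval_C, Pi.smul_apply, smul_eq_mul]
      field_simp
      simp
    · rw [hFP P hP hPQ c, mul_zero]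
  have key := (key_induction v i0 (xr res) (xt res) (xM res) (xM_hom res)
    (fun j x => (xM_exact res j x).1) (fun j u => (xM_exact res j _).2 ⟨u, rfl⟩)
    (minDist Γ) (fun _ => F) (fun _ => Or.inr ⟨_, hF, rfl⟩) hz1 hz2
    (Finset.univ.erase i0) (by simp)).2 n (by simp)
  obtain ⟨z, hz, hzn, -⟩ := key
  obtain ⟨i, hi⟩ : ∃ i, z i ≠ 0 := by
    by_contra! h
    apply hzn 0
    intro i
    simp [h i]
  have hle : xt res n i ≤ minDist Γ + n := by
    rcases hz i with h | ⟨d, -, hd⟩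
    · exact absurd h hi
    · omega
  have hA : res.aMin ≤ minDist Γ + n := by
    obtain ⟨k, rfl⟩ : ∃ k, n = k + 1 := ⟨n - 1, by omega⟩
    obtain ⟨i', hi'⟩ : ∃ i' : Fin (res.rk res.len), res.twist res.len i' ≤ minDist Γ + (k + 1) := by
      rw [hlen]
      exact ⟨i, hle⟩
    exact (Finset.inf'_le _ (Finset.mem_univ i')).trans hi'
  unfold MinFreeRes.A
  rw [hlen]
  omega

end PointsMinDist
end
end

section
/- In the Migliore construction, with t = min{v, β}, the free module R(-(t+n)) is a direct summand of the last module F_n in the graded minimal free resolution of R/I, where I = I_1 ∩ I_2 is the ideal of Γ = Γ_1 ∪ Γ_2; consequently t + n ≥ a(Γ) and t ≥ A_n. -/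
open MvPolynomial

noncomputable section

namespace PointsMinDist

variable {K : Type} [Field K]

/-- Embedding of points of `P^{m-1}` into the hyperplane `x_0 = 0` of `P^m`. -/
def embedPt {m : ℕ} (P : Projectivization K (Fin m → K)) :
    Projectivization K (Fin (m + 1) → K) :=
  Projectivization.mk K (Fin.cons 0 P.rep) (by
    intro h
    apply P.rep_nonzero
    funext i
    simpa using congrFun h i.succ)

/-- The point `[1, c, 1, …, 1]` of `P^n` (a point on a line avoiding `x_0 = 0`). -/
def linePt (n : ℕ) (c : K) : Projectivization K (Fin (n + 1) → K) :=
  Projectivization.mk K (fun j => if (j : ℕ) = 1 then c else 1) (by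
    intro h
    have h0 := congrFun h 0
    simp at h0)

open Classical in
/-- The set `Γ = Γ₁ ∪ Γ₂` of the Migliore construction: a set `Γ₀` of points of
`P^{n-1}` embedded into the hyperplane `x_0 = 0`, together with the points
`[1, u_i, 1, …, 1]` on a line. -/
def MigGamma {n : ℕ} (Γ₀ : Finset (Projectivization K (Fin n → K)))
    {β : ℕ} (u : Fin β → K) : Finset (Projectivization K (Fin (n + 1) → K)) :=
  Γ₀.image embedPt ∪ Finset.univ.image (fun i => linePt n (u i))

/-- The ideal `I₁ = ⟨x_0, J⟩ ⊆ R = K[x_0, …, x_n]`, where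
`J ⊆ S = K[x_1, …, x_n]` (vars of `S` indexed by `Fin n`, with `X i` of `S`
corresponding to `x_{i+1}` of `R`). -/
def I1 {n : ℕ} (J : Ideal (MvPolynomial (Fin n) K)) :
    Ideal (MvPolynomial (Fin (n + 1)) K) :=
  Ideal.span {X 0} ⊔ Ideal.map (rename (Fin.succ : Fin n → Fin (n + 1))) J

/-- The polynomial `∏_{i=1}^β (u_i x_0 - x_1)`. -/
def prodPoly (n β : ℕ) (u : Fin β → K) : MvPolynomial (Fin (n + 1)) K :=
  ∏ i : Fin β, (C (u i) * X 0 - X 1)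

/-- The ideal `I₂ = ⟨∏ (u_i x_0 - x_1), x_2 - x_0, …, x_n - x_0⟩` of the `β`
points `[1, u_i, 1, …, 1]` on a line. -/
def I2 (n β : ℕ) (u : Fin β → K) : Ideal (MvPolynomial (Fin (n + 1)) K) :=
  Ideal.span ({prodPoly n β u} ∪
    {f | ∃ j : Fin (n + 1), 2 ≤ (j : ℕ) ∧ f = X j - X 0})

/-- The sequence `x_0, x_1^t, x_2, …, x_n`. -/
def ciList (K : Type) [Field K] (n t : ℕ) : List (MvPolynomial (Fin (n + 1)) K) :=
  X 0 :: X 1 ^ t :: ((List.finRange (n + 1)).drop 2).map X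

/-- The complete intersection ideal `⟨x_0, x_1^t, x_2, …, x_n⟩`. -/
def CIdeal (K : Type) [Field K] (n t : ℕ) : Ideal (MvPolynomial (Fin (n + 1)) K) :=
  Ideal.span {f | f ∈ ciList K n t}

/-- The set `𝒜 = {x_0(x_2 - x_0), …, x_0(x_n - x_0), x_0·∏(u_i x_0 - x_1)}`. -/
def calA (n β : ℕ) (u : Fin β → K) : Set (MvPolynomial (Fin (n + 1)) K) :=
  {f | ∃ j : Fin (n + 1), 2 ≤ (j : ℕ) ∧ f = X 0 * (X j - X 0)} ∪
    {X 0 * prodPoly n β u}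




theorem alt_sum_apply {K V A ι : Type} [Field K] [AddCommGroup V] [Module K V] [AddCommGroup A]
    [Module K A] {k : ℕ} (s : Finset ι) (f : ι → V [⋀^Fin k]→ₗ[K] A) (v : Fin k → V) :
    (∑ i ∈ s, f i) v = ∑ i ∈ s, f i v := by
  classical
  induction s using Finset.induction_on with
  | empty => simp
  | insert a s ha ih => simp [Finset.sum_insert ha, ih]

/-- Koszul contraction on alternating forms. -/
def iota {K : Type} [Field K] {N k : ℕ} {A : Type} [AddCommGroup A] [Module K A]
    [Module (MvPolynomial (Fin N) K) A] [SMulCommClass K (MvPolynomial (Fin N) K) A]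
    (f : (Fin N → K) [⋀^Fin (k+1)]→ₗ[K] A) : (Fin N → K) [⋀^Fin k]→ₗ[K] A :=
  ∑ j : Fin N, (X j : MvPolynomial (Fin N) K) • f.curryLeft (Pi.single j 1)

section
variable {K : Type} [Field K] {N : ℕ} {A : Type} [AddCommGroup A] [Module K A]
    [Module (MvPolynomial (Fin N) K) A] [SMulCommClass K (MvPolynomial (Fin N) K) A]
    {B : Type} [AddCommGroup B] [Module K B]
    [Module (MvPolynomial (Fin N) K) B] [SMulCommClass K (MvPolynomial (Fin N) K) B]

theorem iota_apply {k : ℕ} (f : (Fin N → K) [⋀^Fin (k+1)]→ₗ[K] A) (v : Fin k → Fin N → K) :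
    iota f v = ∑ j : Fin N, (X j : MvPolynomial (Fin N) K) • f (Matrix.vecCons (Pi.single j 1) v) := by
  simp [iota, alt_sum_apply]

theorem iota_sub {k : ℕ} (f g : (Fin N → K) [⋀^Fin (k+1)]→ₗ[K] A) :
    iota (f - g) = iota f - iota g := by
  ext v
  simp [iota_apply, smul_sub]

theorem iota_add {k : ℕ} (f g : (Fin N → K) [⋀^Fin (k+1)]→ₗ[K] A) :
    iota (f + g) = iota f + iota g := by
  ext v
  simp [iota_apply, smul_add, Finset.sum_add_distrib]

theorem iota_iota {k : ℕ} (f : (Fin N → K) [⋀^Fin (k+2)]→ₗ[K] A) : iota (iota f) = 0 := by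
  ext v
  simp only [iota_apply, Finset.smul_sum]
  have anti : ∀ x y : Fin N → K, f (Matrix.vecCons x (Matrix.vecCons y v)) =
      - f (Matrix.vecCons y (Matrix.vecCons x v)) := by
    intro x y
    have h := DFunLike.congr_fun (f.curryLeft_same (x + y)) v
    have hx := DFunLike.congr_fun (f.curryLeft_same x) v
    have hy := DFunLike.congr_fun (f.curryLeft_same y) v
    simp only [map_add, AlternatingMap.curryLeft_add, LinearMap.add_apply,
      AlternatingMap.add_apply, AlternatingMap.curryLeft_apply_apply, AlternatingMap.zero_apply] at h hx hy
    rw [hx, hy, zero_add, add_zero] at h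
    rw [eq_neg_iff_add_eq_zero, add_comm]
    exact h
  have hxx : ∀ x : Fin N → K, f (Matrix.vecCons x (Matrix.vecCons x v)) = 0 := by
    intro x
    exact DFunLike.congr_fun (f.curryLeft_same x) v
  simp only [smul_smul]
  rw [← Finset.sum_product', AlternatingMap.zero_apply]
  refine Finset.sum_involution (fun p _ => (p.2, p.1)) ?_ ?_ ?_ ?_
  · rintro ⟨a, b⟩ _
    simp only
    rw [anti (Pi.single b 1) (Pi.single a 1), mul_comm, smul_neg]
    simp
  · rintro ⟨a, b⟩ _ h h2
    simp only [Prod.mk.injEq] at h2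
    apply h
    simp only
    rw [h2.1, hxx, smul_zero]
  · simp
  · simp

theorem iota_comp {k : ℕ} (φ : A →ₗ[MvPolynomial (Fin N) K] B) (φ' : A →ₗ[K] B)
    (hφ : ∀ a, φ' a = φ a) (f : (Fin N → K) [⋀^Fin (k+1)]→ₗ[K] A) :
    iota (φ'.compAlternatingMap f) = φ'.compAlternatingMap (iota f) := by
  ext v
  simp [iota_apply, hφ]

end

section homotopy
variable {K : Type} [Field K] {N : ℕ}

/-- directional derivative applied to a form -/
def dirForm {k : ℕ} (f : (Fin N → K) [⋀^Fin k]→ₗ[K] MvPolynomial (Fin N) K) :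
    (Fin N → K) →ₗ[K] (Fin N → K) [⋀^Fin k]→ₗ[K] MvPolynomial (Fin N) K :=
  ∑ j : Fin N, (LinearMap.proj (R := K) (φ := fun _ : Fin N => K) j).smulRight
    (((pderiv j : Derivation K (MvPolynomial (Fin N) K) (MvPolynomial (Fin N) K)) :
      MvPolynomial (Fin N) K →ₗ[K] MvPolynomial (Fin N) K).compAlternatingMap f)

theorem dirForm_apply {k : ℕ} (f : (Fin N → K) [⋀^Fin k]→ₗ[K] MvPolynomial (Fin N) K)
    (x : Fin N → K) (v : Fin k → Fin N → K) :
    dirForm f x v = ∑ j, x j • pderiv j (f v) := by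
  simp [dirForm, LinearMap.sum_apply, alt_sum_apply]

theorem vecCons_lin {k : ℕ} (f : (Fin N → K) [⋀^Fin (k+1)]→ₗ[K] MvPolynomial (Fin N) K)
    (x : Fin N → K) (v : Fin k → Fin N → K) :
    f (Matrix.vecCons x v) = ∑ j, x j • f (Matrix.vecCons (Pi.single j 1) v) := by
  have hx : x = ∑ j, x j • (Pi.single j 1 : Fin N → K) := by
    ext i
    simp [Finset.sum_apply, Pi.single_apply]
  have := congrArg (fun z => f.curryLeft z v) hx
  simpa [map_sum, alt_sum_apply] using this

theorem cartan {k : ℕ} (f : (Fin N → K) [⋀^Fin (k+1)]→ₗ[K] MvPolynomial (Fin N) K)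
    (hf : iota f = 0) (v : Fin (k+1) → Fin N → K) :
    iota (AlternatingMap.alternatizeUncurryFin (dirForm f)) v =
      (∑ j, X j * pderiv j (f v)) + (k+1 : ℕ) • f v := by
  rw [iota_apply]
  simp only [AlternatingMap.alternatizeUncurryFin_apply]
  simp only [Fin.sum_univ_succ (n := k+1)]
  simp only [smul_add, Finset.sum_add_distrib]
  congr 1
  · refine Finset.sum_congr rfl fun j _ => ?_
    simp only [Fin.val_zero, pow_zero, one_smul, smul_eq_mul]
    congr 1
    have : (Fin.removeNth 0 (Matrix.vecCons (Pi.single j 1 : Fin N → K) v)) = v := by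
      ext i; simp [Fin.removeNth]
    rw [this, dirForm_apply]
    simp [Pi.single_apply]
  · simp only [Finset.smul_sum]
    rw [Finset.sum_comm]
    have : ∀ q : Fin (k+1), ∑ j, (X j : MvPolynomial (Fin N) K) • (-1 : ℤ) ^ ((q.succ : Fin (k+2)) : ℕ) •
        dirForm f (Matrix.vecCons (Pi.single j 1 : Fin N → K) v q.succ)
          (Fin.removeNth q.succ (Matrix.vecCons (Pi.single j 1 : Fin N → K) v)) = f v := by
      intro q
      have h0 : ∑ l, v q l • pderiv l (iota f (q.removeNth v)) = 0 := by
        rw [hf]; simp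
      rw [iota_apply] at h0
      simp only [smul_eq_mul, map_sum, Derivation.leibniz, pderiv_X, Finset.smul_sum,
        Finset.sum_add_distrib, smul_add] at h0
      have h1 : ∑ x, ∑ i, v q x • (f (Matrix.vecCons (Pi.single i 1) (q.removeNth v)) *
          (Pi.single x 1 : Fin N → MvPolynomial (Fin N) K) i) = f (Matrix.vecCons (v q) (q.removeNth v)) := by
        rw [vecCons_lin]
        refine Finset.sum_congr rfl fun x _ => ?_
        simp [Pi.single_apply]
      have h2 : ∀ j, Fin.removeNth q.succ (Matrix.vecCons (Pi.single j 1 : Fin N → K) v) =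
          Matrix.vecCons (Pi.single j 1) (q.removeNth v) := by
        intro j
        ext i
        refine Fin.cases ?_ (fun i => ?_) i
        · simp [Fin.removeNth]
        · simp [Fin.removeNth]
      simp only [h2, Matrix.cons_val_succ, dirForm_apply]
      rw [h1] at h0
      have h3 := f.map_insertNth q (v q) (q.removeNth v)
      rw [Fin.insertNth_self_removeNth] at h3
      rw [h3, eq_neg_of_add_eq_zero_right h0]
      rw [Finset.sum_comm]
      simp only [Fin.val_succ, pow_succ, Finset.smul_sum, smul_neg, ← Finset.sum_neg_distrib]
      refine Finset.sum_congr rfl fun j _ => Finset.sum_congr rfl fun l _ => ?_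
      rcases neg_one_pow_eq_or ℤ (q : ℕ) with h | h <;> simp [h]
    rw [Finset.sum_congr rfl fun q _ => this q]
    simp

/-- divide degree `m` part by `m + k` -/
def divDeg (K : Type) [Field K] (N k : ℕ) : MvPolynomial (Fin N) K →ₗ[K] MvPolynomial (Fin N) K :=
  (basisMonomials (Fin N) K).constr K (fun m => monomial m (((m.degree + k : ℕ) : K)⁻¹))

theorem divDeg_monomial (k : ℕ) (m : Fin N →₀ ℕ) (c : K) :
    divDeg K N k (monomial m c) = monomial m (c * ((m.degree + k : ℕ) : K)⁻¹) := by
  have : monomial m c = c • (basisMonomials (Fin N) K m) := by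
    simp [smul_monomial]
  rw [this, map_smul, divDeg, Module.Basis.constr_basis, smul_monomial, smul_eq_mul]

theorem X_mul_divDeg (k : ℕ) (j : Fin N) (p : MvPolynomial (Fin N) K) :
    X j * divDeg K N (k+1) p = divDeg K N k (X j * p) := by
  induction p using MvPolynomial.induction_on' with
  | monomial m c =>
    rw [divDeg_monomial, X, monomial_mul, monomial_mul, divDeg_monomial]
    congr 1
    simp only [one_mul, map_add, Finsupp.degree_single]
    congr 3
    ring
  | add p q hp hq => simp [mul_add, hp, hq]

theorem euler_divDeg [CharZero K] (k : ℕ) (p : MvPolynomial (Fin N) K) :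
    (∑ j, X j * pderiv j (divDeg K N (k+1) p)) + (k+1 : ℕ) • divDeg K N (k+1) p = p := by
  induction p using MvPolynomial.induction_on' with
  | monomial m c =>
    rw [divDeg_monomial]
    simp only [X_mul_pderiv_monomial]
    rw [← Finset.sum_smul, ← add_smul, smul_monomial]
    congr 1
    rw [← Finsupp.degree_eq_sum, nsmul_eq_mul]
    have : ((m.degree + (k+1) : ℕ) : K) ≠ 0 := by
      rw [Nat.cast_ne_zero]; omega
    field_simp
  | add p q hp hq =>
    conv_rhs => rw [← hp, ← hq]
    simp only [map_add, mul_add, Finset.sum_add_distrib, smul_add]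
    abel

theorem koszul_exact1 [CharZero K] {k : ℕ} (f : (Fin N → K) [⋀^Fin (k+1)]→ₗ[K] MvPolynomial (Fin N) K)
    (hf : iota f = 0) : ∃ g : (Fin N → K) [⋀^Fin (k+2)]→ₗ[K] MvPolynomial (Fin N) K, iota g = f := by
  refine ⟨AlternatingMap.alternatizeUncurryFin (dirForm ((divDeg K N (k+1)).compAlternatingMap f)), ?_⟩
  ext1 v
  rw [cartan]
  · exact euler_divDeg k (f v)
  · ext1 w
    have h := DFunLike.congr_fun hf w
    rw [iota_apply] at h ⊢
    simp only [LinearMap.compAlternatingMap_apply, smul_eq_mul, X_mul_divDeg] at h ⊢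
    rw [← map_sum, h]; simp

theorem koszul_exact [CharZero K] {k a : ℕ}
    (f : (Fin N → K) [⋀^Fin (k+1)]→ₗ[K] (Fin a → MvPolynomial (Fin N) K))
    (hf : iota f = 0) :
    ∃ g : (Fin N → K) [⋀^Fin (k+2)]→ₗ[K] (Fin a → MvPolynomial (Fin N) K), iota g = f := by
  have h : ∀ i : Fin a, ∃ g : (Fin N → K) [⋀^Fin (k+2)]→ₗ[K] MvPolynomial (Fin N) K,
      iota g = (LinearMap.proj (R := K) (φ := fun _ : Fin a => MvPolynomial (Fin N) K) i).compAlternatingMap f := by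
    intro i
    apply koszul_exact1
    rw [iota_comp (LinearMap.proj (R := MvPolynomial (Fin N) K) (φ := fun _ : Fin a => MvPolynomial (Fin N) K) i) _ (fun _ => rfl), hf]
    ext; simp
  choose g hg using h
  refine ⟨AlternatingMap.pi g, ?_⟩
  ext1 v
  funext i
  have := DFunLike.congr_fun (hg i) v
  simp only [iota_apply] at this ⊢
  simpa using this

end homotopy

section graded
variable {K : Type} [Field K] {N : ℕ}

/-- degree `d` part of `R(-a)` -/
def hc (a d : ℕ) : MvPolynomial (Fin N) K →ₗ[K] MvPolynomial (Fin N) K :=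
  if a ≤ d then homogeneousComponent (d - a) else 0

theorem coeff_hc (a d : ℕ) (p : MvPolynomial (Fin N) K) (m : Fin N →₀ ℕ) :
    coeff m (hc a d p) = if m.degree + a = d then coeff m p else 0 := by
  unfold hc
  split_ifs with h1 h2 h2
  · rw [coeff_homogeneousComponent, if_pos (by omega)]
  · rw [coeff_homogeneousComponent, if_neg (by omega)]
  · omega
  · simp

theorem hc_mul (a b d : ℕ) (M p : MvPolynomial (Fin N) K)
    (hM : ∀ m, coeff m M ≠ 0 → m.degree + a = b) : hc a d (M * p) = M * hc b d p := by
  ext m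
  rw [coeff_hc, coeff_mul, coeff_mul]
  split_ifs with h
  · refine Finset.sum_congr rfl fun x hx => ?_
    by_cases h0 : coeff x.1 M = 0
    · simp [h0]
    · have := hM _ h0
      have h3 := Finset.HasAntidiagonal.mem_antidiagonal.mp hx
      rw [← h3, map_add] at h
      rw [coeff_hc, if_pos (by omega)]
  · symm
    refine Finset.sum_eq_zero fun x hx => ?_
    by_cases h0 : coeff x.1 M = 0
    · simp [h0]
    · have := hM _ h0
      have h3 := Finset.HasAntidiagonal.mem_antidiagonal.mp hx
      rw [← h3, map_add] at h
      rw [coeff_hc, if_neg (by omega), mul_zero]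

/-- `y` is homogeneous of degree `d` in `⊕ R(-tw i)` -/
def VDeg {a : ℕ} (tw : Fin a → ℕ) (d : ℕ) (y : Fin a → MvPolynomial (Fin N) K) : Prop :=
  ∀ i m, coeff m (y i) ≠ 0 → m.degree + tw i = d

/-- projection to degree `d` part -/
def vproj {a : ℕ} (tw : Fin a → ℕ) (d : ℕ) :
    (Fin a → MvPolynomial (Fin N) K) →ₗ[K] (Fin a → MvPolynomial (Fin N) K) :=
  LinearMap.pi fun i => hc (tw i) d ∘ₗ LinearMap.proj i

theorem vproj_apply {a : ℕ} (tw : Fin a → ℕ) (d : ℕ) (y : Fin a → MvPolynomial (Fin N) K) (i : Fin a) :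
    vproj tw d y i = hc (tw i) d (y i) := rfl

theorem vproj_deg {a : ℕ} (tw : Fin a → ℕ) (d : ℕ) (y : Fin a → MvPolynomial (Fin N) K) :
    VDeg tw d (vproj tw d y) := by
  intro i m h
  rw [vproj_apply, coeff_hc] at h
  by_contra h'
  simp [h'] at h

theorem vproj_of_deg {a : ℕ} (tw : Fin a → ℕ) (d : ℕ) (y : Fin a → MvPolynomial (Fin N) K)
    (h : VDeg tw d y) : vproj tw d y = y := by
  funext i
  ext m
  rw [vproj_apply, coeff_hc]
  split_ifs with h1
  · rfl
  · by_contra h2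
    exact h1 (h i m (Ne.symm h2))

theorem vproj_mulVec {a b : ℕ} (tw : Fin a → ℕ) (tw' : Fin b → ℕ) (d : ℕ)
    (M : Matrix (Fin a) (Fin b) (MvPolynomial (Fin N) K))
    (hM : ∀ i i' m, coeff m (M i i') ≠ 0 → m.degree + tw i = tw' i')
    (y : Fin b → MvPolynomial (Fin N) K) :
    vproj tw d (M.mulVec y) = M.mulVec (vproj tw' d y) := by
  funext i
  rw [vproj_apply]
  simp only [Matrix.mulVec, dotProduct, map_sum]
  refine Finset.sum_congr rfl fun j _ => ?_
  rw [hc_mul _ (tw' j) d _ _ (hM i j), vproj_apply]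

/-- `mulVec` as `K`-linear map -/
def kmul {a b : ℕ} (M : Matrix (Fin a) (Fin b) (MvPolynomial (Fin N) K)) :
    (Fin b → MvPolynomial (Fin N) K) →ₗ[K] (Fin a → MvPolynomial (Fin N) K) :=
  M.mulVecLin.restrictScalars K

theorem kmul_apply {a b : ℕ} (M : Matrix (Fin a) (Fin b) (MvPolynomial (Fin N) K))
    (y : Fin b → MvPolynomial (Fin N) K) : kmul M y = M.mulVec y := rfl

theorem iota_kmul {a b k : ℕ} (M : Matrix (Fin a) (Fin b) (MvPolynomial (Fin N) K))
    (f : (Fin N → K) [⋀^Fin (k+1)]→ₗ[K] (Fin b → MvPolynomial (Fin N) K)) :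
    iota ((kmul M).compAlternatingMap f) = (kmul M).compAlternatingMap (iota f) :=
  iota_comp M.mulVecLin _ (fun _ => rfl) f

theorem lift_form {a b k : ℕ} (tw : Fin a → ℕ) (tw' : Fin b → ℕ) (d : ℕ)
    (M : Matrix (Fin a) (Fin b) (MvPolynomial (Fin N) K))
    (hM : ∀ i i' m, coeff m (M i i') ≠ 0 → m.degree + tw i = tw' i')
    (c : (Fin N → K) [⋀^Fin k]→ₗ[K] (Fin a → MvPolynomial (Fin N) K))
    (hc : ∀ v, VDeg tw d (c v)) (hr : ∀ v, ∃ z, M.mulVec z = c v) :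
    ∃ w : (Fin N → K) [⋀^Fin k]→ₗ[K] (Fin b → MvPolynomial (Fin N) K),
      (kmul M).compAlternatingMap w = c ∧ ∀ v, VDeg tw' d (w v) := by
  obtain ⟨σ, hσ⟩ := (kmul M).rangeRestrict.exists_rightInverse_of_surjective
    (LinearMap.range_rangeRestrict _)
  have hr' : ∀ v, c v ∈ LinearMap.range (kmul M) := fun v => hr v
  let c' := c.codRestrict (LinearMap.range (kmul M)) hr'
  refine ⟨(vproj tw' d ∘ₗ σ).compAlternatingMap c', ?_, ?_⟩
  · ext1 v
    have h1 := LinearMap.congr_fun hσ (c' v)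
    have h2 : kmul M (σ (c' v)) = c v := congrArg Subtype.val h1
    simp only [LinearMap.compAlternatingMap_apply, LinearMap.comp_apply]
    rw [kmul_apply, ← vproj_mulVec tw tw' d M hM, ← kmul_apply, h2, vproj_of_deg _ _ _ (hc v)]
  · intro v
    exact vproj_deg _ _ _

theorem iota_deg {a k : ℕ} (tw : Fin a → ℕ) (d : ℕ)
    (y : (Fin N → K) [⋀^Fin (k+1)]→ₗ[K] (Fin a → MvPolynomial (Fin N) K))
    (hy : ∀ v, VDeg tw d (y v)) (v) : VDeg tw (d+1) (iota y v) := by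
  intro i m h
  rw [iota_apply, Finset.sum_apply, coeff_sum] at h
  obtain ⟨j, -, hj⟩ := Finset.exists_ne_zero_of_sum_ne_zero h
  rw [Pi.smul_apply, smul_eq_mul, coeff_X_mul'] at hj
  split_ifs at hj with hs
  · have := hy _ i _ hj
    have h2 : m = (m - Finsupp.single j 1) + Finsupp.single j 1 := by
      rw [tsub_add_cancel_of_le]
      rw [Finsupp.single_le_iff]
      exact Nat.one_le_iff_ne_zero.mpr (Finsupp.mem_support_iff.mp hs)
    rw [h2, map_add, Finsupp.degree_single]
    omega
  · exact absurd rfl hj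

theorem poly_sum_X (p : MvPolynomial (Fin N) K) (hp : coeff 0 p = 0) :
    ∃ q : Fin N → MvPolynomial (Fin N) K, p = ∑ j, X j * q j := by
  have h : p ∈ Ideal.span (Set.range (X : Fin N → MvPolynomial (Fin N) K)) := by
    rw [← Set.image_univ, mem_ideal_span_X_image]
    intro m hm
    by_contra h'
    push Not at h'
    have : m = 0 := by ext i; simpa using h' i (Set.mem_univ _)
    subst this
    exact (mem_support_iff.mp hm) hp
  obtain ⟨c, hc⟩ := (Ideal.mem_span_range_iff_exists_fun).mp h
  exact ⟨c, by rw [← hc]; exact Finset.sum_congr rfl fun _ _ => mul_comm _ _⟩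

theorem base_form {b : ℕ} (w : (Fin N → K) [⋀^Fin 0]→ₗ[K] (Fin b → MvPolynomial (Fin N) K))
    (hw : ∀ v i, coeff 0 (w v i) = 0) :
    ∃ e : (Fin N → K) [⋀^Fin 1]→ₗ[K] (Fin b → MvPolynomial (Fin N) K), w = iota e := by
  choose q hq using fun i => poly_sum_X (w 0 i) (hw 0 i)
  refine ⟨AlternatingMap.ofSubsingleton K (Fin N → K) (Fin b → MvPolynomial (Fin N) K) (0 : Fin 1)
    (∑ j, (LinearMap.proj (R := K) (φ := fun _ : Fin N => K) j).smulRight (fun i => q i j)), ?_⟩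
  ext1 v
  rw [iota_apply, Subsingleton.elim v 0]
  funext i
  rw [hq i, Finset.sum_apply]
  refine Finset.sum_congr rfl fun j _ => ?_
  simp [LinearMap.sum_apply, Pi.single_apply, ite_smul]

theorem finish [CharZero K] {a b k : ℕ} (M : Matrix (Fin a) (Fin b) (MvPolynomial (Fin N) K))
    (y : (Fin N → K) [⋀^Fin (k+1)]→ₗ[K] (Fin a → MvPolynomial (Fin N) K))
    (w r : (Fin N → K) [⋀^Fin k]→ₗ[K] (Fin b → MvPolynomial (Fin N) K))
    (e : (Fin N → K) [⋀^Fin (k+1)]→ₗ[K] (Fin b → MvPolynomial (Fin N) K))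
    (hw : (kmul M).compAlternatingMap w = iota y) (hr : (kmul M).compAlternatingMap r = 0)
    (hwe : w = iota e + r) :
    ∃ (g : (Fin N → K) [⋀^Fin (k+2)]→ₗ[K] (Fin a → MvPolynomial (Fin N) K))
      (e : (Fin N → K) [⋀^Fin (k+1)]→ₗ[K] (Fin b → MvPolynomial (Fin N) K)),
      y = iota g + (kmul M).compAlternatingMap e := by
  have h : iota (y - (kmul M).compAlternatingMap e) = 0 := by
    rw [iota_sub, iota_kmul, ← hw, hwe]
    ext1 v
    have := DFunLike.congr_fun hr v
    simp only [LinearMap.compAlternatingMap_apply, AlternatingMap.zero_apply] at this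
    simp [this]
  obtain ⟨g, hg⟩ := koszul_exact _ h
  exact ⟨g, e, by rw [hg]; simp⟩

theorem chain_claim [CharZero K] (rk : ℕ → ℕ) (tw : ∀ j, Fin (rk j) → ℕ)
    (M : ∀ j, Matrix (Fin (rk j)) (Fin (rk (j+1))) (MvPolynomial (Fin N) K))
    (hM : ∀ j i i' m, coeff m (M j i i') ≠ 0 → m.degree + tw j i = tw (j+1) i')
    (hex : ∀ j v, (M j).mulVec v = 0 ↔ ∃ z, (M (j+1)).mulVec z = v)
    (n t : ℕ) (hno : ∀ i, tw n i ≠ t + n) (k : ℕ) : ∀ j, j + k + 1 = n →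
    ∀ y : (Fin N → K) [⋀^Fin (k+1)]→ₗ[K] (Fin (rk j) → MvPolynomial (Fin N) K),
    (∀ v, VDeg (tw j) (t + j) (y v)) → (∀ v, ∃ z, (M j).mulVec z = iota y v) →
    ∃ (g : (Fin N → K) [⋀^Fin (k+2)]→ₗ[K] (Fin (rk j) → MvPolynomial (Fin N) K))
      (e : (Fin N → K) [⋀^Fin (k+1)]→ₗ[K] (Fin (rk (j+1)) → MvPolynomial (Fin N) K)),
      y = iota g + (kmul (M j)).compAlternatingMap e := by
  induction k with
  | zero =>
    intro j hj y hy hr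
    obtain ⟨w, hw, hwd⟩ := lift_form (tw j) (tw (j+1)) (t+j+1) (M j) (hM j) (iota y)
      (iota_deg _ _ y hy) hr
    obtain ⟨e, he⟩ := base_form w (by
      intro v i
      by_contra h
      have := hwd v i 0 h
      simp only [map_zero] at this
      subst hj
      exact hno i (by simp only [Nat.add_zero]; omega))
    refine finish (M j) y w 0 e hw ?_ (by simpa using he)
    ext; simp
  | succ k ih =>
    intro j hj y hy hr
    obtain ⟨w, hw, hwd⟩ := lift_form (tw j) (tw (j+1)) (t+j+1) (M j) (hM j) (iota y)
      (iota_deg _ _ y hy) hr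
    obtain ⟨e, r, he⟩ := ih (j+1) (by omega) w hwd (by
      intro v
      rw [← hex]
      have h := congrArg iota hw
      rw [iota_kmul, iota_iota] at h
      exact DFunLike.congr_fun h v)
    refine finish (M j) y w _ e hw ?_ he
    ext1 v
    exact (hex j _).mpr ⟨_, rfl⟩

theorem top_form {n : ℕ} (I : Ideal (MvPolynomial (Fin (n+1)) K))
    (f : (Fin (n+1) → K) [⋀^Fin (n+1)]→ₗ[K] MvPolynomial (Fin (n+1)) K)
    (hf : ∀ v, iota f v ∈ I) (j : Fin (n+1)) :
    X j * f (fun i => Pi.single i 1) ∈ I := by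
  have h := hf (j.removeNth (fun i => (Pi.single i 1 : Fin (n+1) → K)))
  rw [iota_apply, Finset.sum_eq_single j] at h
  · have h3 := f.map_insertNth j (Pi.single j 1) (j.removeNth (fun i => (Pi.single i 1 : Fin (n+1) → K)))
    have h4 : j.insertNth (Pi.single j 1 : Fin (n+1) → K) (j.removeNth (fun i => (Pi.single i 1 : Fin (n+1) → K))) =
      (fun i => Pi.single i 1) := Fin.insertNth_self_removeNth j (fun i => (Pi.single i 1 : Fin (n+1) → K))
    rw [h4] at h3
    rw [h3]
    rcases neg_one_pow_eq_or ℤ (j : ℕ) with h5 | h5 <;> simp only [h5]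
    · simpa using h
    · simpa using h
  · intro l _ hl
    obtain ⟨i, hi⟩ := Fin.exists_succAbove_eq hl
    rw [AlternatingMap.map_eq_zero_of_eq (i := 0) (j := i.succ), smul_zero]
    · simp [Fin.removeNth, hi]
    · exact (Fin.succ_ne_zero i).symm
  · simp

end graded

section ideals
variable {K : Type} [Field K]

/-- restriction to `x_0 = 0` -/
def rho (n : ℕ) : MvPolynomial (Fin (n+1)) K →ₐ[K] MvPolynomial (Fin n) K :=
  aeval (Fin.cases 0 X)

theorem mem_I1_iff {n : ℕ} (J : Ideal (MvPolynomial (Fin n) K)) (e : MvPolynomial (Fin (n+1)) K) :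
    e ∈ I1 J ↔ rho n e ∈ J := by
  constructor
  · intro h
    have hle : I1 J ≤ J.comap (rho n : MvPolynomial (Fin (n+1)) K →ₐ[K] MvPolynomial (Fin n) K) := by
      refine sup_le ?_ ?_
      · rw [Ideal.span_le]
        rintro x rfl
        simp [rho]
      · rw [Ideal.map_le_iff_le_comap]
        intro f hf
        rw [Ideal.mem_comap, Ideal.mem_comap]
        have : rho n (rename Fin.succ f) = f := by
          rw [rho, aeval_rename]
          have : ((Fin.cases 0 X : Fin (n+1) → MvPolynomial (Fin n) K) ∘ Fin.succ) = X := by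
            funext i; simp
          rw [this, aeval_X_left, AlgHom.id_apply]
        rw [this]; exact hf
    exact hle h
  · intro h
    have h1 : e - rename Fin.succ (rho n e) ∈ Ideal.span {(X 0 : MvPolynomial (Fin (n+1)) K)} := by
      rw [← Ideal.Quotient.eq]
      have : ((Ideal.Quotient.mkₐ K (Ideal.span {(X 0 : MvPolynomial (Fin (n+1)) K)}))) =
          (Ideal.Quotient.mkₐ K (Ideal.span {(X 0 : MvPolynomial (Fin (n+1)) K)})).comp
            ((rename Fin.succ).comp (rho n)) := by
        apply algHom_ext
        intro i
        refine Fin.cases ?_ (fun i => ?_) i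
        · simp only [rho, AlgHom.comp_apply, aeval_X, Fin.cases_zero, map_zero]
          exact Ideal.Quotient.eq_zero_iff_mem.mpr (Ideal.mem_span_singleton_self _)
        · simp [rho]
      exact DFunLike.congr_fun this e
    have h2 : rename Fin.succ (rho n e) ∈ I1 J :=
      Ideal.mem_sup_right (Ideal.mem_map_of_mem _ h)
    have := add_mem (Ideal.mem_sup_left h1 : _ ∈ I1 J) h2
    rwa [sub_add_cancel] at this

theorem I1_depth {n : ℕ} (Γ : Set (Projectivization K (Fin n → K))) (e : MvPolynomial (Fin (n+1)) K)
    (h : ∀ j, X j * e ∈ I1 (vanishingIdeal Γ)) : e ∈ I1 (vanishingIdeal Γ) := by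
  rw [mem_I1_iff]
  intro P hP w hw hwP
  obtain ⟨i, hi⟩ : ∃ i, w i ≠ 0 := by
    by_contra h'
    push Not at h'
    exact hw (funext h')
  have h1 := (mem_I1_iff _ _).mp (h i.succ) P hP w hw hwP
  rw [map_mul, map_mul] at h1
  have : rho n (X i.succ : MvPolynomial (Fin (n+1)) K) = X i := by simp [rho]
  rw [this, eval_X] at h1
  exact (mul_eq_zero.mp h1).resolve_left hi

/-- restriction to the line -/
def theta (m : ℕ) : MvPolynomial (Fin (m+2)) K →ₐ[K] MvPolynomial (Fin (m+2)) K :=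
  aeval (fun j => if j = 1 then X 1 else X 0)

theorem theta_X0 (m : ℕ) : theta m (X 0 : MvPolynomial (Fin (m+2)) K) = X 0 := by
  simp [theta]

theorem theta_X1 (m : ℕ) : theta m (X 1 : MvPolynomial (Fin (m+2)) K) = X 1 := by
  simp [theta]

theorem fin_ne_one {m : ℕ} {j : Fin (m+2)} (hj : 2 ≤ (j : ℕ)) : j ≠ 1 := by
  rintro rfl
  simp at hj

theorem fin_ne_zero' {m : ℕ} {j : Fin (m+2)} (hj : 2 ≤ (j : ℕ)) : j ≠ 0 := by
  rintro rfl
  simp at hj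

theorem mem_I2_iff {m β : ℕ} (u : Fin β → K) (e : MvPolynomial (Fin (m+2)) K) :
    e ∈ I2 (m+1) β u ↔ prodPoly (m+1) β u ∣ theta m e := by
  constructor
  · intro h
    have hle : I2 (m+1) β u ≤ (Ideal.span {prodPoly (m+1) β u}).comap (theta (K := K) m) := by
      rw [I2, Ideal.span_le]
      rintro x (rfl | ⟨j, hj, rfl⟩)
      · rw [SetLike.mem_coe, Ideal.mem_comap]
        have : theta m (prodPoly (m+1) β u) = prodPoly (m+1) β u := by
          simp only [prodPoly, map_prod, map_sub, map_mul, theta_X0, theta_X1]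
          simp [theta]
        rw [this]
        exact Ideal.mem_span_singleton_self _
      · rw [SetLike.mem_coe, Ideal.mem_comap]
        simp [theta, fin_ne_one hj]
    exact Ideal.mem_span_singleton.mp (hle h)
  · intro h
    have h1 : e - theta m e ∈ I2 (m+1) β u := by
      rw [← Ideal.Quotient.eq]
      have : ((Ideal.Quotient.mkₐ K (I2 (m+1) β u))) =
          (Ideal.Quotient.mkₐ K (I2 (m+1) β u)).comp (theta m) := by
        apply algHom_ext
        intro i
        rw [AlgHom.comp_apply]
        by_cases h1 : i = 1
        · subst h1; rw [theta_X1]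
        by_cases h0 : i = 0
        · subst h0; rw [theta_X0]
        have hi : 2 ≤ (i : ℕ) := by
          have a : (i : ℕ) ≠ 0 := fun h => h0 (Fin.ext (by simpa using h))
          have b : (i : ℕ) ≠ 1 := fun h => h1 (Fin.ext (by simpa using h))
          omega
        have : theta m (X i : MvPolynomial (Fin (m+2)) K) = X 0 := by simp [theta, h1]
        rw [this]
        exact Ideal.Quotient.eq.mpr (Ideal.subset_span (Or.inr ⟨i, hi, rfl⟩))
      exact DFunLike.congr_fun this e
    have h2 : theta m e ∈ I2 (m+1) β u :=
      Ideal.mem_of_dvd _ h (Ideal.subset_span (Or.inl rfl))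
    simpa using add_mem h1 h2

theorem I2_depth {m β : ℕ} (u : Fin β → K) (e : MvPolynomial (Fin (m+2)) K)
    (h : X 0 * e ∈ I2 (m+1) β u) : e ∈ I2 (m+1) β u := by
  rw [mem_I2_iff] at h ⊢
  rw [map_mul, theta_X0] at h
  obtain ⟨c, hc⟩ := h
  have hp : Prime (X 0 : MvPolynomial (Fin (m+2)) K) := X_prime
  have hnd : ¬ (X 0 : MvPolynomial (Fin (m+2)) K) ∣ prodPoly (m+1) β u := by
    rintro ⟨d, hd⟩
    have := congrArg (eval (fun j : Fin (m+2) => if j = 1 then (1 : K) else 0)) hd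
    simp [prodPoly] at this
  rcases hp.dvd_or_dvd (Dvd.intro _ hc) with h | ⟨d, rfl⟩
  · exact absurd h hnd
  · refine ⟨d, mul_left_cancel₀ hp.ne_zero ?_⟩
    rw [hc]; ring

/-- specialization to `K[T]` -/
def chi (m : ℕ) : MvPolynomial (Fin (m+2)) K →ₐ[K] Polynomial K :=
  aeval (fun j => if j = 1 then Polynomial.X else 0)

theorem socle_not_mem {m β v : ℕ} (hβ : 0 < β) (hv0 : 0 < v) (u : Fin β → K) (J : Ideal (MvPolynomial (Fin (m+1)) K))
    (hv : J ⊔ Ideal.span {f | ∃ i : Fin (m+1), 1 ≤ (i : ℕ) ∧ f = X i} =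
      Ideal.span ({X (0 : Fin (m+1)) ^ v} ∪ {f | ∃ i : Fin (m+1), 1 ≤ (i : ℕ) ∧ f = X i})) :
    (X 1 : MvPolynomial (Fin (m+2)) K) ^ (min v β - 1) ∉ I1 J ⊔ I2 (m+1) β u := by
  intro h
  have hle : I1 J ⊔ I2 (m+1) β u ≤
      (Ideal.span {(Polynomial.X : Polynomial K) ^ (min v β)}).comap (chi (K := K) m) := by
    refine sup_le (sup_le ?_ ?_) ?_
    · rw [Ideal.span_le]
      rintro x rfl
      rw [SetLike.mem_coe, Ideal.mem_comap]
      simp [chi]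
    · rw [Ideal.map_le_iff_le_comap]
      have h1 : J ≤ Ideal.span ({X (0 : Fin (m+1)) ^ v} ∪ {f | ∃ i : Fin (m+1), 1 ≤ (i : ℕ) ∧ f = X i}) := by
        rw [← hv]; exact le_sup_left
      refine h1.trans ?_
      rw [Ideal.span_le]
      rintro x (rfl | ⟨j, hj, rfl⟩)
      · rw [SetLike.mem_coe, Ideal.mem_comap, Ideal.mem_comap]
        have : chi m (rename Fin.succ ((X 0 : MvPolynomial (Fin (m+1)) K) ^ v)) = Polynomial.X ^ v := by
          simp [chi]
        rw [this]
        exact Ideal.mem_span_singleton.mpr (pow_dvd_pow _ (min_le_left _ _))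
      · rw [SetLike.mem_coe, Ideal.mem_comap, Ideal.mem_comap]
        have hj0 : j.succ ≠ 1 := by
          intro h
          have := congrArg Fin.val h
          simp at this
          simp [this] at hj
        have : chi m (rename Fin.succ (X j : MvPolynomial (Fin (m+1)) K)) = 0 := by
          simp [chi, hj0]
        rw [this]
        exact zero_mem _
    · rw [I2, Ideal.span_le]
      rintro x (rfl | ⟨j, hj, rfl⟩)
      · rw [SetLike.mem_coe, Ideal.mem_comap]
        have : chi m (prodPoly (m+1) β u) = (-Polynomial.X) ^ β := by
          simp [chi, prodPoly, map_prod]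
        rw [this, neg_pow]
        exact Ideal.mul_mem_left _ _ (Ideal.mem_span_singleton.mpr (pow_dvd_pow _ (min_le_right _ _)))
      · rw [SetLike.mem_coe, Ideal.mem_comap]
        simp [chi, fin_ne_one hj]
  have h2 := hle h
  rw [Ideal.mem_comap, Ideal.mem_span_singleton] at h2
  have h3 : chi m ((X 1 : MvPolynomial (Fin (m+2)) K) ^ (min v β - 1)) = Polynomial.X ^ (min v β - 1) := by
    simp [chi]
  rw [h3, Polynomial.X_pow_dvd_iff] at h2
  have h4 := h2 (min v β - 1) (by have := lt_min hv0 hβ; omega)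
  simp at h4

theorem coeff_aeval_ray {n : ℕ} (w : Fin n → K) (d : ℕ) (f : MvPolynomial (Fin n) K) :
    (aeval (fun i => Polynomial.C (w i) * Polynomial.X) f : Polynomial K).coeff d =
      eval w (homogeneousComponent d f) := by
  induction f using MvPolynomial.induction_on' with
  | monomial m c =>
    have h1 : (aeval (fun i => Polynomial.C (w i) * Polynomial.X) (monomial m c) : Polynomial K) =
        Polynomial.C (eval w (monomial m c)) * Polynomial.X ^ m.degree := by
      rw [aeval_monomial, eval_monomial, Finsupp.prod, Finsupp.prod, Finsupp.degree_apply]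
      simp only [mul_pow, Finset.prod_mul_distrib, Finset.prod_pow_eq_pow_sum, map_mul, map_prod, map_pow]
      rw [Polynomial.algebraMap_eq, mul_assoc]
    rw [h1, Polynomial.coeff_C_mul_X_pow,
      homogeneousComponent_of_mem (isHomogeneous_monomial c rfl)]
    split_ifs <;> simp_all
  | add p q hp hq => simp [hp, hq]

theorem vanishing_homog [CharZero K] {n : ℕ} (Γ : Set (Projectivization K (Fin n → K)))
    (f : MvPolynomial (Fin n) K) (hf : f ∈ vanishingIdeal Γ) (d : ℕ) :
    homogeneousComponent d f ∈ vanishingIdeal Γ := by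
  intro P hP w hw hwP
  rw [← coeff_aeval_ray]
  have hz : (aeval (fun i => Polynomial.C (w i) * Polynomial.X) f : Polynomial K) = 0 := by
    apply Polynomial.eq_zero_of_infinite_isRoot
    refine Set.Infinite.mono ?_ (Set.finite_singleton (0 : K)).infinite_compl
    intro c hc
    have hc0 : c ≠ 0 := hc
    have h1 := hf P hP (c • w) (smul_ne_zero hc0 hw) (by
      rw [← hwP, Projectivization.mk_eq_mk_iff']
      exact ⟨c, rfl⟩)
    show Polynomial.eval c _ = 0
    rw [← h1, ← Polynomial.coe_aeval_eq_eval, ← AlgHom.coe_toRingHom, ← coe_aeval_eq_eval]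
    have : (Polynomial.aeval c).comp (aeval (fun i => Polynomial.C (w i) * Polynomial.X)) =
        (aeval (c • w) : MvPolynomial (Fin n) K →ₐ[K] K) := by
      apply algHom_ext
      intro i
      rw [AlgHom.comp_apply, aeval_X, aeval_X, map_mul, Polynomial.aeval_C, Polynomial.aeval_X,
        Pi.smul_apply, smul_eq_mul, mul_comm]
      rfl
    exact DFunLike.congr_fun this f
  rw [hz, Polynomial.coeff_zero]

/-- the lifting `x_i ↦ x_{i+1} - x_0` -/
def psi (m : ℕ) : MvPolynomial (Fin (m+1)) K →ₐ[K] MvPolynomial (Fin (m+2)) K :=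
  aeval (fun i => if i = 0 then X 1 else X i.succ - X 0)

theorem exists_q_v [CharZero K] {m β v : ℕ} (u : Fin β → K) (Γ : Set (Projectivization K (Fin (m+1) → K)))
    (hv : vanishingIdeal Γ ⊔ Ideal.span {f | ∃ i : Fin (m+1), 1 ≤ (i : ℕ) ∧ f = X i} =
      Ideal.span ({X (0 : Fin (m+1)) ^ v} ∪ {f | ∃ i : Fin (m+1), 1 ≤ (i : ℕ) ∧ f = X i})) :
    ∃ q : MvPolynomial (Fin (m+2)) K, q.IsHomogeneous v ∧ q ∈ I2 (m+1) β u ∧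
      X 1 ^ v - q ∈ I1 (vanishingIdeal Γ) := by
  have hx : (X (0 : Fin (m+1)) : MvPolynomial (Fin (m+1)) K) ^ v ∈ vanishingIdeal Γ ⊔
      Ideal.span {f | ∃ i : Fin (m+1), 1 ≤ (i : ℕ) ∧ f = X i} := by
    rw [hv]; exact Ideal.subset_span (Or.inl rfl)
  obtain ⟨f, hf, g, hg, hfg⟩ := Submodule.mem_sup.mp hx
  have hset : {f : MvPolynomial (Fin (m+1)) K | ∃ i : Fin (m+1), 1 ≤ (i : ℕ) ∧ f = X i} =
      X '' {i : Fin (m+1) | 1 ≤ (i : ℕ)} := by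
    ext f
    simp only [Set.mem_ofPred_eq, Set.mem_image]
    exact ⟨fun ⟨i, h, e⟩ => ⟨i, h, e.symm⟩, fun ⟨i, h, e⟩ => ⟨i, h, e.symm⟩⟩
  have hg' : homogeneousComponent v g ∈ Ideal.span {f : MvPolynomial (Fin (m+1)) K |
      ∃ i : Fin (m+1), 1 ≤ (i : ℕ) ∧ f = X i} := by
    rw [hset, mem_ideal_span_X_image] at hg ⊢
    intro a ha
    apply hg
    rw [mem_support_iff, coeff_homogeneousComponent] at ha
    rw [mem_support_iff]
    intro h
    simp [h] at ha
  have hf' := vanishing_homog Γ f hf v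
  have hsum : homogeneousComponent v f + homogeneousComponent v g = X 0 ^ v := by
    rw [← map_add, hfg]
    exact homogeneousComponent_eq_self (isHomogeneous_X_pow _ _)
  refine ⟨psi m (homogeneousComponent v g), ?_, ?_, ?_⟩
  · have := (homogeneousComponent_isHomogeneous v g).aeval (S := K)
      (fun i : Fin (m+1) => if i = 0 then (X 1 : MvPolynomial (Fin (m+2)) K) else X i.succ - X 0) (n := 1) (by
        intro i
        split_ifs
        · exact isHomogeneous_X _ _
        · exact (isHomogeneous_X _ _).sub (isHomogeneous_X _ _))
    rw [one_mul] at this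
    exact this
  · have hle : Ideal.span {f : MvPolynomial (Fin (m+1)) K | ∃ i : Fin (m+1), 1 ≤ (i : ℕ) ∧ f = X i} ≤
        (I2 (m+1) β u).comap (psi m) := by
      rw [Ideal.span_le]
      rintro x ⟨i, hi, rfl⟩
      have hi0 : i ≠ 0 := by rintro rfl; simp at hi
      rw [SetLike.mem_coe, Ideal.mem_comap]
      have : psi m (X i : MvPolynomial (Fin (m+1)) K) = X i.succ - X 0 := by simp [psi, hi0]
      rw [this]
      exact Ideal.subset_span (Or.inr ⟨i.succ, by simp; omega, rfl⟩)
    exact hle hg'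
  · have h1 : (X 1 : MvPolynomial (Fin (m+2)) K) ^ v - psi m (homogeneousComponent v g) =
        psi m (homogeneousComponent v f) := by
      rw [sub_eq_iff_eq_add, ← map_add, hsum]
      simp [psi]
    rw [h1, mem_I1_iff]
    have : (rho (m+1)).comp (psi (K := K) m) = AlgHom.id K _ := by
      apply algHom_ext
      intro i
      by_cases h : i = 0
      · subst h
        simp only [psi, rho, AlgHom.comp_apply, aeval_X, if_true]
        rw [← Fin.succ_zero_eq_one, Fin.cases_succ]; rfl
      · simp [psi, rho, h]
    rw [show rho (m+1) (psi m (homogeneousComponent v f)) = homogeneousComponent v f from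
      DFunLike.congr_fun this _]
    exact hf'

theorem exists_q_beta {m β : ℕ} (u : Fin β → K) (J : Ideal (MvPolynomial (Fin (m+1)) K)) :
    ∃ q : MvPolynomial (Fin (m+2)) K, q.IsHomogeneous β ∧ q ∈ I2 (m+1) β u ∧
      X 1 ^ β - q ∈ I1 J := by
  refine ⟨C ((-1) ^ β) * prodPoly (m+1) β u, ?_, ?_, ?_⟩
  · apply IsHomogeneous.C_mul
    have := IsHomogeneous.prod (Finset.univ : Finset (Fin β))
      (fun i => (C (u i) * X 0 - X 1 : MvPolynomial (Fin (m+2)) K)) (fun _ => 1)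
      (fun i _ => (isHomogeneous_C_mul_X _ _).sub (isHomogeneous_X _ _))
    simpa [prodPoly] using this
  · exact Ideal.mul_mem_left _ _ (Ideal.subset_span (Or.inl rfl))
  · rw [mem_I1_iff]
    have h1 : rho (m+1) (X 1 : MvPolynomial (Fin (m+2)) K) = X 0 := by
      rw [rho, aeval_X, ← Fin.succ_zero_eq_one, Fin.cases_succ]
    have h0 : rho (m+1) (X 0 : MvPolynomial (Fin (m+2)) K) = 0 := by
      rw [rho, aeval_X, Fin.cases_zero]
    have hC : ∀ c : K, rho (m+1) (C c : MvPolynomial (Fin (m+2)) K) = C c := fun c => by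
      simp [rho]
    have : rho (m+1) (X 1 ^ β - C ((-1) ^ β) * prodPoly (m+1) β u) = 0 := by
      simp only [prodPoly, map_sub, map_mul, map_pow, map_prod, h1, h0, hC, mul_zero, zero_sub,
        Finset.prod_const, Finset.card_univ, Fintype.card_fin]
      rw [← mul_pow]
      simp
    rw [this]
    exact zero_mem _

theorem exists_Q [CharZero K] {m β v : ℕ} (hβ : 0 < β) (hv0 : 0 < v) (u : Fin β → K)
    (Γ : Set (Projectivization K (Fin (m+1) → K)))
    (hv : vanishingIdeal Γ ⊔ Ideal.span {f | ∃ i : Fin (m+1), 1 ≤ (i : ℕ) ∧ f = X i} =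
      Ideal.span ({X (0 : Fin (m+1)) ^ v} ∪ {f | ∃ i : Fin (m+1), 1 ≤ (i : ℕ) ∧ f = X i}))
    (j : Fin (m+2)) :
    ∃ q : MvPolynomial (Fin (m+2)) K, q.IsHomogeneous (min v β) ∧ q ∈ I2 (m+1) β u ∧
      X j * X 1 ^ (min v β - 1) - q ∈ I1 (vanishingIdeal Γ) := by
  have ht : min v β - 1 + 1 = min v β := by have := lt_min hv0 hβ; omega
  have hX0 : (X 0 : MvPolynomial (Fin (m+2)) K) ∈ I1 (vanishingIdeal Γ) :=
    Ideal.mem_sup_left (Ideal.mem_span_singleton_self _)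
  by_cases h1 : j = 1
  · subst h1
    rw [← pow_succ', ht]
    rcases le_total v β with h | h
    · rw [min_eq_left h]; exact exists_q_v u Γ hv
    · rw [min_eq_right h]; exact exists_q_beta u _
  by_cases h0 : j = 0
  · subst h0
    refine ⟨0, isHomogeneous_zero _ _ _, zero_mem _, ?_⟩
    rw [sub_zero]
    exact Ideal.mul_mem_right _ _ hX0
  have hi : 2 ≤ (j : ℕ) := by
    have a : (j : ℕ) ≠ 0 := fun h => h0 (Fin.ext (by simpa using h))
    have b : (j : ℕ) ≠ 1 := fun h => h1 (Fin.ext (by simpa using h))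
    omega
  refine ⟨(X j - X 0) * X 1 ^ (min v β - 1), ?_, ?_, ?_⟩
  · have := ((isHomogeneous_X K j).sub (isHomogeneous_X K 0)).mul
      (isHomogeneous_X_pow (R := K) (1 : Fin (m+2)) (min v β - 1))
    rwa [add_comm 1 (min v β - 1), ht] at this
  · exact Ideal.mul_mem_right _ _ (Ideal.subset_span (Or.inr ⟨j, hi, rfl⟩))
  · rw [← sub_mul, sub_sub_cancel]
    exact Ideal.mul_mem_right _ _ hX0

end ideals

section main
variable {K : Type} [Field K]

/-- ranks, including `F_0 = R` -/
def rkx {N : ℕ} {I : Ideal (MvPolynomial (Fin N) K)} (res : MinFreeRes N K I) : ℕ → ℕ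
  | 0 => 1
  | j+1 => res.rk (j+1)

/-- twists, including `F_0 = R` -/
def twx {N : ℕ} {I : Ideal (MvPolynomial (Fin N) K)} (res : MinFreeRes N K I) :
    (j : ℕ) → Fin (rkx res j) → ℕ
  | 0 => fun _ => 0
  | j+1 => fun i => res.twist (j+1) i

/-- differentials, including `F_1 → R` -/
def matx {N : ℕ} {I : Ideal (MvPolynomial (Fin N) K)} (res : MinFreeRes N K I) :
    (j : ℕ) → Matrix (Fin (rkx res j)) (Fin (rkx res (j+1))) (MvPolynomial (Fin N) K)
  | 0 => Matrix.of fun _ i => res.gen i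
  | j+1 => res.mat j

theorem matx_zero_mulVec {N : ℕ} {I : Ideal (MvPolynomial (Fin N) K)} (res : MinFreeRes N K I)
    (z : Fin (res.rk 1) → MvPolynomial (Fin N) K) (i : Fin 1) :
    (matx res 0).mulVec z i = ∑ l, z l * res.gen l := by
  show ∑ l, res.gen l * z l = _
  exact Finset.sum_congr rfl fun _ _ => mul_comm _ _

theorem matx_hom {N : ℕ} {I : Ideal (MvPolynomial (Fin N) K)} (res : MinFreeRes N K I)
    (j i i' m) (h : coeff m (matx res j i i') ≠ 0) : m.degree + twx res j i = twx res (j+1) i' := by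
  cases j with
  | zero =>
    have h1 : coeff m (res.gen i') ≠ 0 := h
    show m.degree + 0 = res.twist 1 i'
    by_contra h2
    exact h1 ((res.gen_hom i').coeff_eq_zero h2)
  | succ j =>
    have h1 : coeff m (res.mat j i i') ≠ 0 := h
    show m.degree + res.twist (j+1) i = res.twist (j+2) i'
    rcases res.mat_hom j i i' with h2 | ⟨d, h2, h3⟩
    · rw [h2] at h1; simp at h1
    · rw [← h3]
      by_contra h4
      exact h1 (h2.coeff_eq_zero (fun h => h4 (by rw [h])))

theorem matx_exact {N : ℕ} {I : Ideal (MvPolynomial (Fin N) K)} (res : MinFreeRes N K I)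
    (j v) : (matx res j).mulVec v = 0 ↔ ∃ z, (matx res (j+1)).mulVec z = v := by
  cases j with
  | zero =>
    have h := res.exact_one v
    have h2 : (matx res 0).mulVec v = 0 ↔ ∑ i, v i * res.gen i = 0 := by
      constructor
      · intro h
        exact (matx_zero_mulVec res v (0 : Fin 1)).symm.trans (congrFun h (0 : Fin 1))
      · intro h
        funext i
        exact (matx_zero_mulVec res v i).trans h
    exact h2.trans h
  | succ j =>
    have h := SetLike.ext_iff.mp (res.exact_rest j) v
    exact h

theorem mem_iff_matx {N : ℕ} {I : Ideal (MvPolynomial (Fin N) K)} (res : MinFreeRes N K I)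
    (p : MvPolynomial (Fin N) K) :
    p ∈ I ↔ ∃ z, (matx res 0).mulVec z = fun _ => p := by
  have h : p ∈ I ↔ p ∈ Ideal.span (Set.range res.gen) := by rw [res.gen_span]
  rw [h, Ideal.mem_span_range_iff_exists_fun]
  constructor
  · rintro ⟨c, hc⟩
    exact ⟨c, funext fun i => (matx_zero_mulVec res c i).trans hc⟩
  · rintro ⟨c, hc⟩
    exact ⟨c, (matx_zero_mulVec res c (0 : Fin 1)).symm.trans (congrFun hc (0 : Fin 1))⟩

/-- the volume form -/
def volForm (K : Type) [Field K] (N : ℕ) : (Fin N → K) [⋀^Fin N]→ₗ[K] MvPolynomial (Fin N) K :=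
  (Algebra.linearMap K (MvPolynomial (Fin N) K)).compAlternatingMap
    (Matrix.detRowAlternating : (Fin N → K) [⋀^Fin N]→ₗ[K] K)

theorem volForm_std (N : ℕ) : volForm K N (fun i => Pi.single i 1) = 1 := by
  have : (Matrix.detRowAlternating : (Fin N → K) [⋀^Fin N]→ₗ[K] K) (fun i => Pi.single i 1) = 1 := by
    show Matrix.det (fun i => Pi.single i 1) = 1
    rw [← Matrix.det_one (n := Fin N) (R := K)]
    congr 1
    ext i j
    simp [Matrix.one_apply, Pi.single_apply, eq_comm]
  rw [volForm, LinearMap.compAlternatingMap_apply, this]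
  simp

theorem volForm_val (N : ℕ) (v : Fin N → Fin N → K) : ∃ c : K, volForm K N v = C c :=
  ⟨Matrix.det v, rfl⟩

theorem exists_twist [CharZero K] {m β v : ℕ} (hβ : 0 < β) (hv0 : 0 < v) (u : Fin β → K)
    (Γ : Set (Projectivization K (Fin (m+1) → K)))
    (hv : vanishingIdeal Γ ⊔ Ideal.span {f | ∃ i : Fin (m+1), 1 ≤ (i : ℕ) ∧ f = X i} =
      Ideal.span ({X (0 : Fin (m+1)) ^ v} ∪ {f | ∃ i : Fin (m+1), 1 ≤ (i : ℕ) ∧ f = X i}))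
    (res : MinFreeRes (m+2) K (I1 (vanishingIdeal Γ) ⊓ I2 (m+1) β u)) :
    ∃ i, res.twist (m+1) i = min v β + (m+1) := by
  by_contra hno
  push Not at hno
  choose Q hQh hQ2 hQ1 using exists_Q hβ hv0 u Γ hv
  set t := min v β with ht
  let vol := volForm K (m+2)
  let ω : (Fin (m+2) → K) [⋀^Fin (m+2)]→ₗ[K] MvPolynomial (Fin (m+2)) K :=
    (X 1 ^ (t-1) : MvPolynomial (Fin (m+2)) K) • vol
  let y0 : (Fin (m+2) → K) [⋀^Fin (m+1)]→ₗ[K] MvPolynomial (Fin (m+2)) K :=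
    ∑ j, Q j • vol.curryLeft (Pi.single j 1)
  have hy0 : ∀ w, y0 w = ∑ j, Q j * vol (Matrix.vecCons (Pi.single j 1) w) := by
    intro w
    simp [y0, alt_sum_apply]
  have hy2 : ∀ w, y0 w ∈ I2 (m+1) β u := by
    intro w
    rw [hy0]
    exact sum_mem fun j _ => Ideal.mul_mem_right _ _ (hQ2 j)
  have hωy : ∀ w, (iota ω - y0) w ∈ I1 (vanishingIdeal Γ) := by
    intro w
    rw [AlternatingMap.sub_apply, hy0, iota_apply, ← Finset.sum_sub_distrib]
    refine sum_mem fun j _ => ?_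
    have : (X j : MvPolynomial (Fin (m+2)) K) • ω (Matrix.vecCons (Pi.single j 1) w) -
        Q j * vol (Matrix.vecCons (Pi.single j 1) w) =
        (X j * X 1 ^ (t-1) - Q j) * vol (Matrix.vecCons (Pi.single j 1) w) := by
      simp only [ω, AlternatingMap.smul_apply, smul_eq_mul]; ring
    rw [this]
    exact Ideal.mul_mem_right _ _ (hQ1 j)
  have iota_mem : ∀ (I : Ideal (MvPolynomial (Fin (m+2)) K)) (k : ℕ)
      (f : (Fin (m+2) → K) [⋀^Fin (k+1)]→ₗ[K] MvPolynomial (Fin (m+2)) K),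
      (∀ w, f w ∈ I) → ∀ w, iota f w ∈ I := by
    intro I k f hf w
    rw [iota_apply]
    exact sum_mem fun j _ => Ideal.mul_mem_left _ _ (hf _)
  have hιy : ∀ w, iota y0 w ∈ I1 (vanishingIdeal Γ) ⊓ I2 (m+1) β u := by
    intro w
    refine ⟨?_, iota_mem _ _ y0 hy2 w⟩
    have h1 := iota_mem _ _ _ hωy w
    rw [iota_sub, iota_iota, zero_sub, AlternatingMap.neg_apply] at h1
    exact neg_mem_iff.mp h1
  let y : (Fin (m+2) → K) [⋀^Fin (m+1)]→ₗ[K] (Fin (rkx res 0) → MvPolynomial (Fin (m+2)) K) :=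
    AlternatingMap.pi fun _ => y0
  have hyapp : ∀ w, y w = fun _ => y0 w := fun w => rfl
  have hιy' : ∀ w, iota y w = fun _ => iota y0 w := by
    intro w
    rw [iota_apply, iota_apply]
    funext i
    rw [Finset.sum_apply]
    rfl
  obtain ⟨g, e, hge⟩ := chain_claim (rkx res) (twx res) (matx res) (matx_hom res) (matx_exact res)
    (m+1) t hno m 0 (by omega) y (by
      intro w i a ha
      rw [hyapp] at ha
      show a.degree + 0 = t + 0
      have hh : (y0 w).IsHomogeneous t := by
        rw [hy0]
        refine IsHomogeneous.sum _ _ _ fun j _ => ?_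
        obtain ⟨c, hc⟩ := volForm_val (m+2) (Matrix.vecCons (Pi.single j 1) w)
        show (Q j * volForm K (m+2) _).IsHomogeneous t
        rw [hc, mul_comm]
        exact (hQh j).C_mul c
      by_contra h
      exact ha (hh.coeff_eq_zero h)) (by
      intro w
      rw [hιy']
      exact (mem_iff_matx res _).mp (hιy w))
  obtain ⟨z0⟩ : Nonempty (Fin (rkx res 0)) := ⟨(0 : Fin 1)⟩
  let g0 : (Fin (m+2) → K) [⋀^Fin (m+2)]→ₗ[K] MvPolynomial (Fin (m+2)) K :=
    (LinearMap.proj (R := K) (φ := fun _ : Fin (rkx res 0) => MvPolynomial (Fin (m+2)) K)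
      z0).compAlternatingMap g
  have hr : ∀ w, y0 w - iota g0 w ∈ I1 (vanishingIdeal Γ) ⊓ I2 (m+1) β u := by
    intro w
    rw [mem_iff_matx res]
    refine ⟨e w, ?_⟩
    have h1 := DFunLike.congr_fun hge w
    have h2 : iota g0 w = iota g w z0 := by
      rw [iota_apply, iota_apply, Finset.sum_apply]
      rfl
    funext i
    have h3 : i = z0 := Subsingleton.elim (α := Fin 1) i z0
    have h4 := congrFun h1 z0
    rw [h3, h2]
    rw [AlternatingMap.add_apply, Pi.add_apply] at h4
    have h5 : y0 w = iota g w z0 + (matx res 0).mulVec (e w) z0 := h4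
    rw [h5, add_sub_cancel_left]
  have he2 : g0 (fun i => Pi.single i 1) ∈ I2 (m+1) β u := by
    apply I2_depth
    apply top_form
    intro w
    have := sub_mem (hy2 w) (hr w).2
    rwa [sub_sub_cancel] at this
  have he1 : X 1 ^ (t-1) - g0 (fun i => Pi.single i 1) ∈ I1 (vanishingIdeal Γ) := by
    apply I1_depth
    intro j
    have h1 := top_form (I1 (vanishingIdeal Γ)) (ω - g0) (by
      intro w
      have h2 := add_mem (hωy w) (hr w).1
      rw [AlternatingMap.sub_apply, sub_add_sub_cancel] at h2
      rwa [iota_sub, AlternatingMap.sub_apply]) j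
    have h3 : ω (fun i => Pi.single i 1) = X 1 ^ (t-1) := by
      simp only [ω, vol, AlternatingMap.smul_apply, volForm_std, smul_eq_mul, mul_one]
    rwa [AlternatingMap.sub_apply, h3] at h1
  apply socle_not_mem hβ hv0 u _ hv
  have := Submodule.add_mem_sup he1 he2
  rwa [sub_add_cancel] at this

end main

/-- In the Migliore construction, `R(-(t+n))` is a direct
summand of the last module `F_n` of the graded minimal free resolution of
`R/(I₁ ∩ I₂)`; hence `t + n ≥ a(Γ)` and `t ≥ A_n`. -/
theorem migliore_twist_in_last_module
    {K : Type} [Field K] [CharZero K] {n α β : ℕ} (hn : 2 ≤ n)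
    (hα : 0 < α) (hβ : 0 < β)
    (Γ₀ : Finset (Projectivization K (Fin n → K)))
    (hcard : Γ₀.card = α)
    (hgen : ∀ i, HF (vanishingIdeal (Γ₀ : Set (Projectivization K (Fin n → K)))) i =
      min ((i + n - 1).choose (n - 1)) α)
    (u : Fin β → K) (hu : Function.Injective u)
    (s : ℕ) (hs : α < (s + n - 1).choose (n - 1))
    (hsmin : ∀ j, α < (j + n - 1).choose (n - 1) → s ≤ j)
    (v : ℕ) (hvs : v = s ∨ v = s + 1)
    (hv : vanishingIdeal (Γ₀ : Set (Projectivization K (Fin n → K))) ⊔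
        Ideal.span {f | ∃ i : Fin n, 1 ≤ (i : ℕ) ∧ f = X i} =
      Ideal.span ({X (⟨0, by omega⟩ : Fin n) ^ v} ∪ {f | ∃ i : Fin n, 1 ≤ (i : ℕ) ∧ f = X i}))
    (res : MinFreeRes (n + 1) K (I1 (vanishingIdeal (Γ₀ : Set (Projectivization K (Fin n → K)))) ⊓ I2 n β u))
    (hlen : res.len = n) :
    (∃ i, res.twist res.len i = min v β + n) ∧
    res.aMin ≤ min v β + n ∧ res.A ≤ (min v β : ℤ) := by
  obtain ⟨m, rfl⟩ : ∃ m, n = m + 1 := ⟨n - 1, by omega⟩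
  have hs0 : 0 < s := by
    rcases Nat.eq_zero_or_pos s with h | h
    · subst h
      simp at hs
      omega
    · exact h
  have hv0 : 0 < v := by omega
  have hall : ∀ l, l = m + 1 → ∃ i : Fin (res.rk l), res.twist l i = min v β + (m + 1) := by
    rintro _ rfl
    exact exists_twist hβ hv0 u _ hv res
  obtain ⟨i, hi⟩ := hall _ hlen
  have ha : res.aMin ≤ min v β + (m + 1) := hi ▸ Finset.inf'_le _ (Finset.mem_univ i)
  refine ⟨⟨i, hi⟩, ha, ?_⟩
  unfold MinFreeRes.A
  push_cast
  omega

end PointsMinDist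
end
end
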